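/- Let E be an archimedean divisible effect algebra with compression base (J_p)_{p∈P} and let (G, u) be its universal group with the extended compression base. Then E is spectral if and only if G is spectral. In this case, for every a ∈ E: (i) the rational spectral resolution of a computed in E coincides with the rational spectral resolution of a computed in G; (ii) a = lim_{n→∞} Σ_{w∈{0,1}^n} λ(w) u_w in the order-unit norm of G, where u_w = p_{a,λ(w+1)} ∧ p_{a,λ(w)}'; (iii) for b ∈ E, a = b if and only if p_{a,λ(w)} = p_{b,λ(w)} for all binary strings w; (iv) for q ∈ P, a ∈ C(q) if and only if p_{a,λ(w)} ∈ C(q) for all binary strings w. -/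

import Mathlib

/- Common definitions: effect algebras, compression bases, spectrality -/

attribute [local instance 0] Classical.propDecidable

universe u

structure EffectAlgebra (E : Type u) where
  padd : E → E → Option E
  zero : E
  one : E
  comm : ∀ a b, padd a b = padd b a
  assoc : ∀ a b c ab abc, padd a b = some ab → padd ab c = some abc →
      ∃ bc, padd b c = some bc ∧ padd a bc = some abc
  orth_exists : ∀ a, ∃ x, padd a x = some one
  orth_unique : ∀ a x y, padd a x = some one → padd a y = some one → x = y
  add_one : ∀ a b, padd a one = some b → a = zero

namespace EffectAlgebra

variable {E : Type u} (EA : EffectAlgebra E)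

/-- `a ⊥ b` and `a ⊕ b = c`. -/
def le (a b : E) : Prop := ∃ c, EA.padd a c = some b

/-- the orthosupplement `a'`. -/
noncomputable def compl (a : E) : E := (EA.orth_exists a).choose

/-- `b ⊖ a` (the element `c` with `a ⊕ c = b`, when it exists). -/
noncomputable def osub (b a : E) : E :=
  if h : ∃ c, EA.padd a c = some b then h.choose else EA.zero

/-- the value of `a ⊕ b` (defaulting to `0` when undefined). -/
noncomputable def oplusD (a b : E) : E := (EA.padd a b).getD EA.zero

def IsSharp (a : E) : Prop := ∀ x, EA.le x a → EA.le x (EA.compl a) → x = EA.zero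

/-- sub-effect algebra. -/
def SubEA (P : Set E) : Prop :=
  EA.zero ∈ P ∧ EA.one ∈ P ∧ (∀ a ∈ P, EA.compl a ∈ P) ∧
    ∀ a ∈ P, ∀ b ∈ P, ∀ c, EA.padd a b = some c → c ∈ P

/-- Mackey compatibility: `a = a₁ ⊕ c`, `b = b₁ ⊕ c` with `a₁ ⊕ b₁ ⊕ c` defined. -/
def Mackey (a b : E) : Prop :=
  ∃ a1 b1 c d e, EA.padd a1 b1 = some d ∧ EA.padd d c = some e ∧
    EA.padd a1 c = some a ∧ EA.padd b1 c = some b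

def Additive (J : E → E) : Prop :=
  ∀ a b c, EA.padd a b = some c → EA.padd (J a) (J b) = some (J c)

def Retraction (J : E → E) : Prop :=
  EA.Additive J ∧ ∀ a, EA.le a (J EA.one) → J a = a

def Compression (J : E → E) : Prop :=
  EA.Retraction J ∧ ∀ a, (J a = EA.zero ↔ EA.le a (EA.compl (J EA.one)))

/-- `I` is a supplement of `J`: `Ker J = ran I` and `Ker I = ran J`. -/
def Supplement (I J : E → E) : Prop :=
  (∀ a, J a = EA.zero ↔ ∃ b, I b = a) ∧ (∀ a, I a = EA.zero ↔ ∃ b, J b = a)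

/-- the `n`-fold sum `n·a`, when defined. -/
def nsmulE : ℕ → E → Option E
  | 0, _ => some EA.zero
  | n + 1, a => (nsmulE n a).bind fun b => EA.padd a b

def ArchimedeanEA : Prop :=
  ∀ a : E, (∀ n : ℕ, ∃ b, EA.nsmulE n a = some b) → a = EA.zero

/-- a state on an effect algebra. -/
def IsState (s : E → ℝ) : Prop :=
  s EA.one = 1 ∧ (∀ a, 0 ≤ s a ∧ s a ≤ 1) ∧
    ∀ a b c, EA.padd a b = some c → s c = s a + s b

noncomputable def partialSum (f : ℕ → E) : ℕ → E
  | 0 => EA.zero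
  | n + 1 => EA.oplusD (partialSum f n) (f n)

/-- σ-additivity of a state: if all partial sums of an orthogonal sequence are defined
and the orthosum (= supremum of the partial sums) exists, the state is countably additive. -/
def SigmaAdditive (s : E → ℝ) : Prop :=
  ∀ f : ℕ → E, ∀ b : E,
    (∀ n, ∃ c, EA.padd (EA.partialSum f n) (f n) = some c) →
    (∀ n, EA.le (EA.partialSum f n) b) →
    (∀ c, (∀ n, EA.le (EA.partialSum f n) c) → EA.le b c) →
    Filter.Tendsto (fun n => ∑ i ∈ Finset.range n, s (f i)) Filter.atTop (nhds (s b))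

/-- A compression base: a family of compressions indexed by a sub-effect algebra `P`
such that each `p ∈ P` is the focus of `J p`, and Mackey compatible projections
compose to a projection. -/
structure CompressionBase {E : Type u} (EA : EffectAlgebra E) where
  P : Set E
  J : E → E → E
  sub : EA.SubEA P
  compr : ∀ p ∈ P, EA.Compression (J p)
  focus : ∀ p ∈ P, J p EA.one = p
  mackey : ∀ p ∈ P, ∀ q ∈ P, EA.Mackey p q → ∃ r ∈ P, J p ∘ J q = J r

variable (CB : CompressionBase EA)

/-- `a ∈ C(p)`:  `a = J_p(a) ⊕ J_{p'}(a)`. -/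
def inC (a p : E) : Prop :=
  EA.padd (CB.J p a) (CB.J (EA.compl p) a) = some a

/-- `PC(a) = {p ∈ P : a ∈ C(p)}`. -/
def PC (a : E) : Set E := {p | p ∈ CB.P ∧ inC EA CB a p}

/-- the bicommutant `P(a)`. -/
def bicomm (a : E) : Set E :=
  {p | p ∈ PC EA CB a ∧ ∀ q ∈ PC EA CB a, inC EA CB p q}

/-- `PC(A)` for a set `A ⊆ E`. -/
def PCset (A : Set E) : Set E := {p | p ∈ CB.P ∧ ∀ a ∈ A, inC EA CB a p}

/-- `P(Q) = PC(PC(Q) ∪ Q)`. -/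
def Pset (Q : Set E) : Set E := PCset EA CB (PCset EA CB Q ∪ Q)

/-- `P_≤(e,f)`. -/
def Ple (e f : E) : Set E :=
  {p | p ∈ Pset EA CB {e, f} ∧ EA.le (CB.J p e) (CB.J p f) ∧
    EA.le (CB.J (EA.compl p) f) (CB.J (EA.compl p) e)}

/-- a Boolean subalgebra of `P`: a sub-effect algebra of `E` contained in `P`
whose elements are pairwise Mackey compatible, with witnesses inside. -/
def BooleanSub (B : Set E) : Prop :=
  B ⊆ CB.P ∧ EA.SubEA B ∧
    ∀ p ∈ B, ∀ q ∈ B, ∃ p1 ∈ B, ∃ q1 ∈ B, ∃ c ∈ B, ∃ d e,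
      EA.padd p1 q1 = some d ∧ EA.padd d c = some e ∧
      EA.padd p1 c = some p ∧ EA.padd q1 c = some q

/-- `a` is a b-element with associated Boolean subalgebra `B`. -/
def IsBElementWith (a : E) (B : Set E) : Prop :=
  BooleanSub EA CB B ∧ ∀ p ∈ CB.P, (inC EA CB a p ↔ ∀ b ∈ B, inC EA CB b p)

def IsBElement (a : E) : Prop := ∃ B, IsBElementWith EA CB a B

def BProperty : Prop := ∀ a : E, IsBElement EA CB a

/-- commuting of b-elements: `e C f` iff `P(e) ↔ P(f)`. -/
def CommuteEl (e f : E) : Prop :=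
  ∀ p ∈ bicomm EA CB e, ∀ q ∈ bicomm EA CB f, EA.Mackey p q

def BComparability : Prop :=
  BProperty EA CB ∧ ∀ e f : E, CommuteEl EA CB e f → (Ple EA CB e f).Nonempty

def IsProjCover (a p : E) : Prop :=
  p ∈ CB.P ∧ ∀ q ∈ CB.P, (EA.le a q ↔ EA.le p q)

def ProjCoverProp : Prop := ∀ a : E, ∃ p, IsProjCover EA CB a p

def Spectral : Prop := ProjCoverProp EA CB ∧ BComparability EA CB

/-- a block of `P`: a maximal set of pairwise Mackey compatible projections. -/
def IsBlock (B : Set E) : Prop :=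
  B ⊆ CB.P ∧ (∀ p ∈ B, ∀ q ∈ B, EA.Mackey p q) ∧
    ∀ B' : Set E, B' ⊆ CB.P → (∀ p ∈ B', ∀ q ∈ B', EA.Mackey p q) → B ⊆ B' → B' = B

/-- the C-block `C(B)`. -/
def Cblock (B : Set E) : Set E := {a | ∀ p ∈ B, inC EA CB a p}

/-- `(f − e)_+` (the positive part, defined when `P_≤(e,f)` is nonempty). -/
noncomputable def posPart (e f : E) : E :=
  if h : (Ple EA CB e f).Nonempty then
    EA.osub (CB.J h.some f) (CB.J h.some e)
  else EA.zero

noncomputable def projCover (a : E) : E :=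
  if h : ∃ p, IsProjCover EA CB a p then h.choose else EA.zero

def IsMeetP (p q m : E) : Prop :=
  m ∈ CB.P ∧ EA.le m p ∧ EA.le m q ∧ ∀ s ∈ CB.P, EA.le s p → EA.le s q → EA.le s m

/-- `p ∧ q` in `P`. -/
noncomputable def pmeet (p q : E) : E :=
  if h : ∃ m, IsMeetP EA CB p q m then h.choose else EA.zero

/-- infimum of a set of projections in `P`. -/
def IsInfP (S : Set E) (m : E) : Prop :=
  m ∈ CB.P ∧ (∀ s ∈ S, EA.le m s) ∧
    ∀ t ∈ CB.P, (∀ s ∈ S, EA.le t s) → EA.le t m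

/-! Relative (to a projection `q`, i.e. computed in the interval `[0,q]`) notions. -/

def Pq (q : E) : Set E := {p | p ∈ CB.P ∧ EA.le p q}

def inCq (q a p : E) : Prop :=
  EA.padd (CB.J p a) (CB.J (EA.osub q p) a) = some a

def PCq (q a : E) : Set E := {p | p ∈ Pq EA CB q ∧ inCq EA CB q a p}

def bicommq (q a : E) : Set E :=
  {p | p ∈ PCq EA CB q a ∧ ∀ r ∈ PCq EA CB q a, inCq EA CB q p r}

def PCsetq (q : E) (A : Set E) : Set E :=
  {p | p ∈ Pq EA CB q ∧ ∀ a ∈ A, inCq EA CB q a p}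

def Psetq (q : E) (Q : Set E) : Set E := PCsetq EA CB q (PCsetq EA CB q Q ∪ Q)

def Pleq (q e f : E) : Set E :=
  {p | p ∈ Psetq EA CB q {e, f} ∧ EA.le (CB.J p e) (CB.J p f) ∧
    EA.le (CB.J (EA.osub q p) f) (CB.J (EA.osub q p) e)}

noncomputable def posPartq (q e f : E) : E :=
  if h : (Pleq EA CB q e f).Nonempty then
    EA.osub (CB.J h.some f) (CB.J h.some e)
  else EA.zero

def IsProjCoverq (q a p : E) : Prop :=
  p ∈ Pq EA CB q ∧ ∀ s ∈ Pq EA CB q, (EA.le a s ↔ EA.le p s)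

noncomputable def projCoverq (q a : E) : E :=
  if h : ∃ p, IsProjCoverq EA CB q a p then h.choose else EA.zero

def Mackeyq (q a b : E) : Prop :=
  ∃ a1 b1 c d e, EA.padd a1 b1 = some d ∧ EA.padd d c = some e ∧ EA.le e q ∧
    EA.padd a1 c = some a ∧ EA.padd b1 c = some b

def SubEAq (q : E) (F : Set E) : Prop :=
  EA.zero ∈ F ∧ q ∈ F ∧ (∀ x ∈ F, EA.osub q x ∈ F) ∧
    ∀ x ∈ F, ∀ y ∈ F, ∀ z, EA.padd x y = some z → EA.le z q → z ∈ F

def BooleanSubq (q : E) (B : Set E) : Prop :=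
  B ⊆ Pq EA CB q ∧ SubEAq EA q B ∧
    ∀ p ∈ B, ∀ r ∈ B, ∃ p1 ∈ B, ∃ r1 ∈ B, ∃ c ∈ B, ∃ d e,
      EA.padd p1 r1 = some d ∧ EA.padd d c = some e ∧ EA.le e q ∧
      EA.padd p1 c = some p ∧ EA.padd r1 c = some r

def IsBElementq (q a : E) : Prop :=
  ∃ B, BooleanSubq EA CB q B ∧
    ∀ p ∈ Pq EA CB q, (inCq EA CB q a p ↔ ∀ b ∈ B, inCq EA CB q b p)

def BPropertyq (q : E) : Prop := ∀ a : E, EA.le a q → IsBElementq EA CB q a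

def CommuteElq (q e f : E) : Prop :=
  ∀ p ∈ bicommq EA CB q e, ∀ r ∈ bicommq EA CB q f, Mackeyq EA q p r

def BComparabilityq (q : E) : Prop :=
  BPropertyq EA CB q ∧ ∀ e f : E, EA.le e q → EA.le f q →
    CommuteElq EA CB q e f → (Pleq EA CB q e f).Nonempty

/-! The binary spectral resolution. -/

/-- `λ(w) = Σ_j w_j 2^{-j}` (head of the list is the first digit). -/
def lamOf : List Bool → ℚ
  | [] => 0
  | b :: t => ((if b then 1 else 0) + lamOf t) / 2

/-- all binary strings of length `n`, in lexicographic order. -/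
def allStrings : ℕ → List (List Bool)
  | 0 => [[]]
  | n + 1 => (allStrings n).flatMap fun w => [w ++ [false], w ++ [true]]

noncomputable def listSum (l : List E) : E :=
  l.foldl (fun acc x => EA.oplusD acc x) EA.zero

/-- the families `(u_w, c_w)`; the binary string is given in reversed order
(head of the list is the last digit). -/
noncomputable def ucAux (a : E) : List Bool → E × E
  | [] => (projCover EA CB a, a)
  | bit :: t =>
      let p := ucAux a t
      let q := p.1
      let cw := p.2
      let cw' := EA.osub q cw
      let d := posPartq EA CB q cw' cw
      let u0 := pmeet EA CB (EA.osub q (projCoverq EA CB q d)) q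
      if bit then (pmeet EA CB q (EA.compl u0), d)
      else (u0, EA.oplusD (CB.J u0 cw) (CB.J u0 cw))

noncomputable def uw (a : E) (w : List Bool) : E := (ucAux EA CB a w.reverse).1

noncomputable def cw (a : E) (w : List Bool) : E := (ucAux EA CB a w.reverse).2

/-- the binary spectral projection `p_{a,λ(w1)}`. -/
noncomputable def pbin (a : E) (w : List Bool) : E :=
  listSum EA (EA.compl (projCover EA CB a) ::
    (((allStrings (w.length + 1)).filter
        fun v => lamOf v ≤ lamOf (w ++ [false])).map (uw EA CB a)))

def Dyadic01 (x : ℚ) : Prop := ∃ n k : ℕ, (k : ℚ) ≤ 2 ^ n ∧ x = (k : ℚ) / 2 ^ n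

/-- the binary spectral resolution `p_{a,λ}`, for dyadic rationals `λ ∈ [0,1]`. -/
noncomputable def pdyad (a : E) (x : ℚ) : E :=
  if x ≤ 0 then EA.compl (projCover EA CB a)
  else if 1 ≤ x then EA.one
  else if h : ∃ w : List Bool, lamOf (w ++ [true]) = x then pbin EA CB a h.choose
  else EA.zero

/-- the rational spectral resolution `p_{a,λ} = ⋀_{μ > λ, μ dyadic} p_{a,μ}`. -/
noncomputable def ratRes (a : E) (x : ℚ) : E :=
  if h : ∃ m, IsInfP EA CB {y | ∃ μ, Dyadic01 μ ∧ x < μ ∧ y = pdyad EA CB a μ} m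
  then h.choose else EA.zero

/-- the partial maps `f_0(b) = 2b`, `f_1(b) = (2b')'` computed in `[0,uu]`. -/
noncomputable def fstep (uu b : E) (bit : Bool) : Option E :=
  if bit then
    (if EA.le (EA.osub uu b) b
      then some (EA.osub uu (EA.oplusD (EA.osub uu b) (EA.osub uu b))) else none)
  else
    (if EA.le b (EA.osub uu b) then some (EA.oplusD b b) else none)

/-- `f_w = f_{w_n} ∘ ⋯ ∘ f_{w_1}`, computed in `[0,uu]`, as a partial map. -/
noncomputable def fword (uu : E) (w : List Bool) (b : E) : Option E :=
  w.foldl (fun ob bit => ob.bind fun x => fstep EA uu x bit) (some b)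

end EffectAlgebra

namespace EffectAlgebra

/-- `u` is an order unit of the partially ordered abelian group `G`. -/
def OrderUnit {G : Type u} [AddCommGroup G] [PartialOrder G] (unit : G) : Prop :=
  0 ≤ unit ∧ ∀ g : G, ∃ n : ℕ, g ≤ n • unit

/-- the Riesz interpolation property. -/
def RieszInterp (G : Type u) [AddCommGroup G] [PartialOrder G] : Prop :=
  ∀ a b c d : G, a ≤ c → a ≤ d → b ≤ c → b ≤ d → ∃ x, a ≤ x ∧ b ≤ x ∧ x ≤ c ∧ x ≤ d

/-- `p ∈ [0,u]` is sharp: `p ∧ (u − p) = 0`. -/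
def SharpG {G : Type u} [AddCommGroup G] [PartialOrder G] (unit p : G) : Prop :=
  0 ≤ p ∧ p ≤ unit ∧ ∀ x : G, 0 ≤ x → x ≤ p → x ≤ unit - p → x = 0

/-- membership in the convex subgroup `G_p` generated by `p`. -/
def inGp {G : Type u} [AddCommGroup G] [PartialOrder G] (p g : G) : Prop :=
  ∃ n : ℕ, -(n • p) ≤ g ∧ g ≤ n • p

/-- `U` is the projection `Ũ_p` of `G` onto `G_p` with kernel `G_{p'}`. -/
def IsIdealProj {G : Type u} [AddCommGroup G] [PartialOrder G]
    (unit p : G) (U : G → G) : Prop :=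
  (∀ x y, U (x + y) = U x + U y) ∧ (∀ x y : G, x ≤ y → U x ≤ U y) ∧
    (∀ g, inGp p (U g)) ∧ (∀ g, inGp (unit - p) (g - U g)) ∧
    (∀ g, inGp p g → U g = g)

end EffectAlgebra

namespace EffectAlgebra

variable {E : Type u} {G : Type u} [AddCommGroup G] [PartialOrder G]

/-- `g ∈ C(p)` in the group `G` with the extended compression base `Jt`. -/
def inCG (EA : EffectAlgebra E) (Jt : E → G → G) (g : G) (p : E) : Prop :=
  g = Jt p g + Jt (EA.compl p) g

def PCG (EA : EffectAlgebra E) (CB : CompressionBase EA) (Jt : E → G → G)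
    (g : G) : Set E :=
  {p | p ∈ CB.P ∧ inCG EA Jt g p}

/-- the bicommutant `P(g)` of `g ∈ G`. -/
def bicommG (EA : EffectAlgebra E) (CB : CompressionBase EA) (Jt : E → G → G)
    (φ : E → G) (g : G) : Set E :=
  {p | p ∈ PCG EA CB Jt g ∧ ∀ q ∈ PCG EA CB Jt g, inCG EA Jt (φ p) q}

/-- general comparability of `(G,u)` with the extended compression base `Jt`. -/
def GenCompG (EA : EffectAlgebra E) (CB : CompressionBase EA) (Jt : E → G → G)
    (φ : E → G) : Prop :=
  ∀ g : G, ∃ p ∈ bicommG EA CB Jt φ g, Jt (EA.compl p) g ≤ 0 ∧ 0 ≤ Jt p g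

/-- `rick` is a Rickart mapping for `(G,u)` with the compression base `Jt`. -/
def RickartMapG (EA : EffectAlgebra E) (CB : CompressionBase EA) (Jt : E → G → G)
    (rick : G → E) : Prop :=
  ∀ g : G, rick g ∈ CB.P ∧ ∀ p ∈ CB.P,
    (EA.le p (rick g) ↔ (inCG EA Jt g p ∧ Jt p g = 0))

end EffectAlgebra


/-! ### Abstract spectral groups -/

/-- The abstract setting: an archimedean ordered rational vector space with order unit,
a compression base on it, general comparability and the Rickart property. -/
structure SpecGrp (G : Type u) [AddCommGroup G] [PartialOrder G] [IsOrderedAddMonoid G]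
    [Module ℚ G] [PosSMulMono ℚ G] where
  u : G
  P : Set G
  J : G → (G →ₗ[ℚ] G)
  u_nonneg : 0 ≤ u
  unit : ∀ g : G, ∃ n : ℕ, g ≤ n • u
  arch : ∀ x : G, 0 ≤ x → (∀ n : ℕ, n • x ≤ u) → x = 0
  P_zero : 0 ∈ P
  P_compl : ∀ p ∈ P, u - p ∈ P
  P_add : ∀ p ∈ P, ∀ q ∈ P, p + q ≤ u → p + q ∈ P
  P_nonneg : ∀ p ∈ P, 0 ≤ p
  P_le : ∀ p ∈ P, p ≤ u
  J_mono : ∀ p ∈ P, ∀ x y, x ≤ y → J p x ≤ J p y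
  J_unit : ∀ p ∈ P, J p u = p
  J_fix1 : ∀ p ∈ P, ∀ x, 0 ≤ x → x ≤ p → J p x = x
  J_ker1 : ∀ p ∈ P, ∀ x, 0 ≤ x → x ≤ u → J p x = 0 → J (u - p) x = x
  J_mackey : ∀ p ∈ P, ∀ q ∈ P, ∀ a b c, 0 ≤ a → 0 ≤ b → 0 ≤ c → a + b + c ≤ u →
    p = a + c → q = b + c → ∃ r ∈ P, ∀ x, J p (J q x) = J r x
  gencomp : ∀ g, ∃ p ∈ P, g = J p g + J (u - p) g ∧
    (∀ q ∈ P, g = J q g + J (u - q) g → p = J q p + J (u - q) p) ∧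
    J (u - p) g ≤ 0 ∧ 0 ≤ J p g
  cover : ∀ x, 0 ≤ x → x ≤ u → ∃ r ∈ P, ∀ q ∈ P, (x ≤ q ↔ r ≤ q)

namespace SpecGrp

variable {G : Type u} [AddCommGroup G] [PartialOrder G] [IsOrderedAddMonoid G]
    [Module ℚ G] [PosSMulMono ℚ G] (S : SpecGrp G)

def C (g p : G) : Prop := g = S.J p g + S.J (S.u - p) g

theorem cc (p : G) : S.u - (S.u - p) = p := by abel

theorem bnd (x : G) : ∃ N : ℚ, 0 < N ∧ x ≤ N • S.u := by
  obtain ⟨n, hn⟩ := S.unit x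
  refine ⟨n + 1, by positivity, ?_⟩
  have : (n : ℚ) • S.u = n • S.u := Nat.cast_smul_eq_nsmul ℚ n S.u
  have h2 := S.u_nonneg
  rw [add_smul, this, one_smul]
  exact hn.trans (le_add_of_nonneg_right h2)

variable {S}
variable {p q r s t g x y : G}

theorem J_nonneg (hp : p ∈ S.P) (hx : 0 ≤ x) : 0 ≤ S.J p x := by
  simpa using S.J_mono p hp 0 x hx

theorem J_nonpos (hp : p ∈ S.P) (hx : x ≤ 0) : S.J p x ≤ 0 := by
  simpa using S.J_mono p hp x 0 hx

theorem J_fix (hp : p ∈ S.P) {N : ℚ} (hN : 0 < N) (hx : 0 ≤ x) (hxp : x ≤ N • p) :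
    S.J p x = x := by
  have hN' : (0:ℚ) ≤ N⁻¹ := by positivity
  have h := S.J_fix1 p hp (N⁻¹ • x) (smul_nonneg hN' hx) (by
    have := smul_le_smul_of_nonneg_left hxp hN'
    rwa [smul_smul, inv_mul_cancel₀ hN.ne', one_smul] at this)
  rw [map_smul] at h
  have h2 := congrArg (fun y => N • y) h
  simpa [smul_smul, mul_inv_cancel₀ hN.ne'] using h2

theorem J_self (hp : p ∈ S.P) : S.J p p = p :=
  S.J_fix1 p hp p (S.P_nonneg p hp) le_rfl

theorem J_compl (hp : p ∈ S.P) : S.J p (S.u - p) = 0 := by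
  rw [map_sub, S.J_unit p hp, J_self hp, sub_self]

theorem J_zero (hp : p ∈ S.P) {N : ℚ} (hx : 0 ≤ x) (hxp : x ≤ N • (S.u - p)) :
    S.J p x = 0 := by
  refine le_antisymm ?_ (J_nonneg hp hx)
  simpa [J_compl hp] using S.J_mono p hp _ _ hxp

theorem J_le_smul (hp : p ∈ S.P) {N : ℚ} (hxp : x ≤ N • S.u) :
    S.J p x ≤ N • p := by
  simpa [S.J_unit p hp] using S.J_mono p hp _ _ hxp

theorem J_ker (hp : p ∈ S.P) (hx : 0 ≤ x) (h : S.J p x = 0) : S.J (S.u - p) x = x := by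
  obtain ⟨N, hN, hxN⟩ := S.bnd x
  have hN' : (0:ℚ) ≤ N⁻¹ := by positivity
  have h := S.J_ker1 p hp (N⁻¹ • x) (smul_nonneg hN' hx) (by
    have := smul_le_smul_of_nonneg_left hxN hN'
    rwa [smul_smul, inv_mul_cancel₀ hN.ne', one_smul] at this) (by simp [h])
  rw [map_smul] at h
  have h2 := congrArg (fun y => N • y) h
  simpa [smul_smul, mul_inv_cancel₀ hN.ne'] using h2

theorem ext_pos (S : SpecGrp G) (f g : G →ₗ[ℚ] G) (h : ∀ x, 0 ≤ x → f x = g x) (x : G) :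
    f x = g x := by
  obtain ⟨N, hN, hxN⟩ := S.bnd (-x)
  have h1 := h (x + N • S.u) (by
    have := add_le_add_right hxN x
    simpa using this)
  have h2 := h (N • S.u) (smul_nonneg hN.le S.u_nonneg)
  rw [map_add, map_add, h2] at h1
  exact add_right_cancel h1

theorem J_of_le (hp : p ∈ S.P) (hq : q ∈ S.P) (h : q ≤ p) (x : G) :
    S.J p (S.J q x) = S.J q x := by
  refine S.ext_pos (S.J p ∘ₗ S.J q) (S.J q) (fun x hx => ?_) x
  obtain ⟨N, hN, hxN⟩ := S.bnd x
  exact J_fix hp hN (J_nonneg hq hx)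
    ((J_le_smul hq hxN).trans (smul_le_smul_of_nonneg_left h hN.le))

theorem J_of_orth (hp : p ∈ S.P) (hq : q ∈ S.P) (h : q ≤ S.u - p) (x : G) :
    S.J p (S.J q x) = 0 := by
  refine S.ext_pos (S.J p ∘ₗ S.J q) 0 (fun x hx => ?_) x
  obtain ⟨N, hN, hxN⟩ := S.bnd x
  exact J_zero hp (N := N) (J_nonneg hq hx)
    ((J_le_smul hq hxN).trans (smul_le_smul_of_nonneg_left h hN.le))

theorem J_J (hp : p ∈ S.P) (x : G) : S.J p (S.J p x) = S.J p x := J_of_le hp hp le_rfl x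

theorem J_Jc (hp : p ∈ S.P) (x : G) : S.J p (S.J (S.u - p) x) = 0 :=
  J_of_orth hp (S.P_compl p hp) le_rfl x

theorem Jc_J (hp : p ∈ S.P) (x : G) : S.J (S.u - p) (S.J p x) = 0 :=
  J_of_orth (S.P_compl p hp) hp (by rw [S.cc]) x

theorem C.compl (h : S.C g p) : S.C g (S.u - p) := by
  unfold C at *; rw [S.cc, add_comm]; exact h

theorem C.add (h : S.C x p) (h2 : S.C y p) : S.C (x + y) p := by
  unfold C at *; rw [map_add, map_add]; nth_rw 1 [h, h2]; abel

theorem C.smul (h : S.C x p) (n : ℚ) : S.C (n • x) p := by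
  unfold C at *; rw [map_smul, map_smul]; nth_rw 1 [h]; module

theorem C.sub (h : S.C x p) (h2 : S.C y p) : S.C (x - y) p := by
  unfold C at *; rw [map_sub, map_sub]; nth_rw 1 [h, h2]; abel

theorem C_u (hp : p ∈ S.P) : S.C S.u p := by
  unfold C; rw [S.J_unit p hp, S.J_unit _ (S.P_compl p hp)]; abel

theorem C_zero : S.C 0 p := by simp [C]

theorem C_J (hp : p ∈ S.P) (x : G) : S.C (S.J p x) p := by
  unfold C; rw [J_J hp, Jc_J hp, add_zero]

theorem C_le (hp : p ∈ S.P) (hx : 0 ≤ x) (h : x ≤ p) : S.C x p := by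
  have := S.J_fix1 p hp x hx h
  rw [← this]; exact C_J hp x

theorem C_orth (hp : p ∈ S.P) (hx : 0 ≤ x) (h : x ≤ S.u - p) : S.C x p := by
  have := (C_le (S.P_compl p hp) hx h).compl
  rwa [S.cc] at this

theorem C_of_ker (hp : p ∈ S.P) (hx : 0 ≤ x) (h : S.J p x = 0) : S.C x p := by
  unfold C; rw [J_ker hp hx h, h, zero_add]

theorem symm_aux (hp : p ∈ S.P) (hq : q ∈ S.P) (h : S.C p q) :
    S.C q p ∧ S.J p q = S.J q p ∧ ∃ r ∈ S.P, ∀ x, S.J p (S.J q x) = S.J r x := by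
  have hq' := S.P_compl q hq
  have hp' := S.P_compl p hp
  set c := S.J q p with hc
  set a := S.J (S.u - q) p with ha
  have hpe : p = c + a := h
  have hc0 : 0 ≤ c := J_nonneg hq (S.P_nonneg p hp)
  have ha0 : 0 ≤ a := J_nonneg hq' (S.P_nonneg p hp)
  have hcp : c ≤ p := by rw [hpe]; exact le_add_of_nonneg_right ha0
  have hcq : c ≤ q := by
    have := S.J_mono q hq _ _ (S.P_le p hp); rwa [S.J_unit q hq] at this
  have haq : a ≤ S.u - q := by
    have := S.J_mono _ hq' _ _ (S.P_le p hp); rwa [S.J_unit _ hq'] at this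
  have hqc : q - c ≤ S.u - p := by
    linear_combination (norm := exact le_of_eq (by module)) haq + hpe.le
  have e1 : S.J p c = c := S.J_fix1 p hp c hc0 hcp
  have e2 : S.J p (q - c) = 0 := J_zero hp (N := 1) (sub_nonneg.2 hcq) (by simpa using hqc)
  have e3 : S.J (S.u - p) (q - c) = q - c := S.J_fix1 _ hp' _ (sub_nonneg.2 hcq) hqc
  have e4 : S.J (S.u - p) c = 0 := J_zero hp' (N := 1) hc0 (by simpa using hcp)
  have f1 : S.J p q = c := by rw [map_sub, e1, sub_eq_zero] at e2; exact e2
  have f2 : S.J (S.u - p) q = q - c := by rw [map_sub, e4, sub_zero] at e3; exact e3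
  refine ⟨?_, f1, ?_⟩
  · unfold C; rw [f1, f2]; abel
  · refine S.J_mackey p hp q hq a (q - c) c ha0 (sub_nonneg.2 hcq) hc0 ?_ ?_ ?_
    · linear_combination (norm := exact le_of_eq (by module)) haq
    · rw [hpe]; abel
    · abel

theorem C.symm (h : S.C p q) (hp : p ∈ S.P) (hq : q ∈ S.P) : S.C q p :=
  (symm_aux hp hq h).1

theorem meet_eq (hp : p ∈ S.P) (hq : q ∈ S.P) (h : S.C p q) :
    S.J p q ∈ S.P ∧ ∀ x, S.J p (S.J q x) = S.J (S.J p q) x := by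
  obtain ⟨-, -, r, hr, hx⟩ := symm_aux hp hq h
  have := hx S.u
  rw [S.J_unit q hq, S.J_unit r hr] at this
  rw [this]; exact ⟨hr, hx⟩

theorem J_comm (hp : p ∈ S.P) (hq : q ∈ S.P) (h : S.C p q) (x : G) :
    S.J p (S.J q x) = S.J q (S.J p x) := by
  rw [(meet_eq hp hq h).2, (meet_eq hq hp (h.symm hp hq)).2, (symm_aux hp hq h).2.1]

theorem J_le_self (hp : p ∈ S.P) (hx : x ≤ S.u) : S.J p x ≤ p := by
  have := S.J_mono p hp _ _ hx
  rwa [S.J_unit p hp] at this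

theorem C_meet (hp : p ∈ S.P) (hq : q ∈ S.P) (h : S.C p q) (gp : S.C g p) (gq : S.C g q) :
    S.C g (S.J p q) := by
  have hq' := S.P_compl q hq
  have hp' := S.P_compl p hp
  obtain ⟨hr, hJr⟩ := meet_eq hp hq h
  have hpq' : S.C p (S.u - q) := h.compl
  obtain ⟨hs, hJs⟩ := meet_eq hp hq' hpq'
  have hr' := S.P_compl _ hr
  have hrp : S.J p q ≤ p := J_le_self hp (S.P_le q hq)
  have e1 : g = S.J (S.J p q) g + S.J (S.J p (S.u - q)) g + S.J (S.u - p) g := by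
    rw [← hJr, ← hJs, ← map_add]
    have gq' : g = S.J q g + S.J (S.u - q) g := gq
    rw [← gq']; exact gp
  have e2 := congrArg (S.J (S.u - S.J p q)) e1
  rw [map_add, map_add, Jc_J hr, J_of_le hr' hs, J_of_le hr' hp'] at e2
  · unfold C
    rw [e2, zero_add, ← add_assoc]; exact e1
  · exact sub_le_sub_left hrp _
  · rw [map_sub, S.J_unit p hp]; exact sub_le_sub_right (S.P_le p hp) _

theorem C_Jcomm (hp : p ∈ S.P) (hq : q ∈ S.P) (h : S.C p q) (gq : S.C g q) :
    S.C (S.J p g) q := by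
  unfold C
  rw [← J_comm hp hq h, ← J_comm hp (S.P_compl q hq) h.compl, ← map_add]
  exact congrArg _ gq

theorem sup_le (hr : r ∈ S.P) (hs : 0 ≤ s) (ht : 0 ≤ t) (hsr : s ≤ r) (htr : t ≤ r)
    (hst : s + t ≤ S.u) : s + t ≤ r := by
  have := J_le_self hr hst
  rwa [map_add, S.J_fix1 r hr s hs hsr, S.J_fix1 r hr t ht htr] at this

theorem C_P_le (hp : p ∈ S.P) (hq : q ∈ S.P) (h : q ≤ p) : S.C p q :=
  (C_le hp (S.P_nonneg q hq) h).symm hq hp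

theorem P_sub (hp : p ∈ S.P) (hq : q ∈ S.P) (h : q ≤ p) : p - q ∈ S.P := by
  have h1 : (S.u - p) + q ≤ S.u := by
    linear_combination (norm := exact le_of_eq (by module)) h
  have := S.P_compl _ (S.P_add _ (S.P_compl p hp) q hq h1)
  convert this using 1; abel

theorem J_sub (hp : p ∈ S.P) (hq : q ∈ S.P) (h : q ≤ p) (x : G) :
    S.J (p - q) x = S.J p (S.J (S.u - q) x) := by
  have h1 : S.C p (S.u - q) := (C_P_le hp hq h).compl
  rw [(meet_eq hp (S.P_compl q hq) h1).2, map_sub, S.J_unit p hp,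
    S.J_fix1 p hp q (S.P_nonneg q hq) h]

theorem J_sub' (hp : p ∈ S.P) (hq : q ∈ S.P) (h : q ≤ p) (x : G) :
    S.J (p - q) x = S.J (S.u - q) (S.J p x) := by
  rw [J_sub hp hq h]
  exact J_comm hp (S.P_compl q hq) (C_P_le hp hq h).compl x

/-! covers and positive parts -/

def IsCov (S : SpecGrp G) (x r : G) : Prop :=
  r ∈ S.P ∧ ∀ q ∈ S.P, (S.J (S.u - q) x = 0 ↔ r ≤ q)

theorem cov_exists (hx : 0 ≤ x) : ∃ r, S.IsCov x r := by
  obtain ⟨N, hN, hxN⟩ := S.bnd x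
  have hN' : (0:ℚ) ≤ N⁻¹ := by positivity
  have hy0 : 0 ≤ N⁻¹ • x := smul_nonneg hN' hx
  have hyu : N⁻¹ • x ≤ S.u := by
    have := smul_le_smul_of_nonneg_left hxN hN'
    rwa [smul_smul, inv_mul_cancel₀ hN.ne', one_smul] at this
  obtain ⟨r, hr, h⟩ := S.cover _ hy0 hyu
  refine ⟨r, hr, fun q hq => ?_⟩
  have hq' := S.P_compl q hq
  rw [← h q hq]
  constructor
  · intro e
    have := J_ker hq' hx e
    rw [S.cc] at this
    rw [← this, ← map_smul]
    exact J_le_self hq hyu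
  · intro e
    have := J_zero hq' (N := 1) hy0 (by simpa using e)
    rw [map_smul] at this
    have := congrArg (fun y => N • y) this
    simpa [smul_smul, mul_inv_cancel₀ hN.ne'] using this

theorem rickart (S : SpecGrp G) (g : G) :
    ∃ r ∈ S.P, ∀ p ∈ S.P, (p ≤ r ↔ (S.C g p ∧ S.J p g = 0)) := by
  obtain ⟨p, hp, gp, bi, neg, pos⟩ := S.gencomp g
  have hp' := S.P_compl p hp
  have neg' := neg_nonneg.2 neg
  obtain ⟨r, hr, hcov⟩ := cov_exists (S := S) (add_nonneg pos neg')
  refine ⟨S.u - r, S.P_compl r hr, fun q hq => ?_⟩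
  have hq' := S.P_compl q hq
  rw [le_sub_comm, ← hcov _ hq', S.cc, map_add]
  constructor
  · intro h
    obtain ⟨h1, h2⟩ := (add_eq_zero_iff_of_nonneg (J_nonneg hq pos) (J_nonneg hq neg')).1 h
    have c1 := C_of_ker hq pos h1
    have c2 := C_of_ker hq neg' h2
    have e : g = S.J p g - -S.J (S.u - p) g := by rw [sub_neg_eq_add]; exact gp
    refine ⟨by rw [e]; exact c1.sub c2, ?_⟩
    rw [e, map_sub, h1, h2, sub_zero]
  · rintro ⟨c, h⟩
    have hc : S.C p q := bi q hq c
    have hc' : S.C (S.u - p) q := (C_u hq).sub hc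
    rw [map_neg, ← J_comm hp hq hc, ← J_comm hp' hq hc', h]
    simp

theorem cov_unique (h : S.IsCov x r) (h2 : S.IsCov x s) : r = s :=
  le_antisymm ((h.2 s h2.1).1 ((h2.2 s h2.1).2 le_rfl)) ((h2.2 r h.1).1 ((h.2 r h.1).2 le_rfl))

theorem cov_ker (h : S.IsCov x r) : S.J (S.u - r) x = 0 := (h.2 r h.1).2 le_rfl

theorem cov_fix (h : S.IsCov x r) (hx : 0 ≤ x) : S.J r x = x := by
  have := J_ker (S.P_compl r h.1) hx (cov_ker h)
  rwa [S.cc] at this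

theorem cov_C (hx : 0 ≤ x) (hr : S.IsCov x r) (hq : q ∈ S.P) (h : S.C x q) : S.C r q := by
  have hq' := S.P_compl q hq
  have hr' := S.P_compl r hr.1
  obtain ⟨s, hs⟩ := cov_exists (S := S) (J_nonneg hq hx)
  obtain ⟨t, ht⟩ := cov_exists (S := S) (J_nonneg hq' hx)
  have hs0 := S.P_nonneg s hs.1
  have ht0 := S.P_nonneg t ht.1
  have hsq : s ≤ q := (hs.2 q hq).1 (Jc_J hq x)
  have htq : t ≤ S.u - q := (ht.2 _ hq').1 (by rw [S.cc]; exact J_Jc hq x)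
  have hst : s + t ≤ S.u := by
    linear_combination (norm := exact le_of_eq (by module)) hsq + htq
  have hP := S.P_add s hs.1 t ht.1 hst
  have hP' := S.P_compl _ hP
  have h1 : r ≤ s + t := by
    refine (hr.2 _ hP).1 ?_
    have hx' : x = S.J q x + S.J (S.u - q) x := h
    rw [hx', map_add, ← cov_fix hs (J_nonneg hq hx), ← cov_fix ht (J_nonneg hq' hx),
      J_of_orth hP' hs.1, J_of_orth hP' ht.1, add_zero]
    · rw [S.cc]; exact le_add_of_nonneg_left hs0
    · rw [S.cc]; exact le_add_of_nonneg_right ht0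
  have h2 : s ≤ r := by
    refine (hs.2 r hr.1).1 (le_antisymm ?_ (J_nonneg hr' (J_nonneg hq hx)))
    rw [← cov_ker hr]
    refine S.J_mono _ hr' _ _ ?_
    have hx' : x = S.J q x + S.J (S.u - q) x := h
    nth_rw 2 [hx']
    exact le_add_of_nonneg_right (J_nonneg hq' hx)
  have h3 : t ≤ r := by
    refine (ht.2 r hr.1).1 (le_antisymm ?_ (J_nonneg hr' (J_nonneg hq' hx)))
    rw [← cov_ker hr]
    refine S.J_mono _ hr' _ _ ?_
    have hx' : x = S.J q x + S.J (S.u - q) x := h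
    nth_rw 2 [hx']
    exact le_add_of_nonneg_left (J_nonneg hq hx)
  have h4 : r = s + t := le_antisymm h1 (sup_le hr.1 hs0 ht0 h2 h3 hst)
  rw [h4]
  exact (C_le hq hs0 hsq).add (C_orth hq ht0 htq)

theorem posp_unique (hp : p ∈ S.P) (hq : q ∈ S.P) (gp : S.C g p) (gq : S.C g q) (hpq : S.C p q)
    (p1 : 0 ≤ S.J p g) (p2 : S.J (S.u - p) g ≤ 0) (q1 : 0 ≤ S.J q g)
    (q2 : S.J (S.u - q) g ≤ 0) : S.J p g = S.J q g := by
  have hq' := S.P_compl q hq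
  have hp' := S.P_compl p hp
  have e1 : S.J (S.u - q) (S.J p g) = 0 := by
    refine le_antisymm ?_ (J_nonneg hq' p1)
    rw [← J_comm hp hq' hpq.compl]; exact J_nonpos hp q2
  have hqp := hpq.symm hp hq
  have e2 : S.J (S.u - p) (S.J q g) = 0 := by
    refine le_antisymm ?_ (J_nonneg hp' q1)
    rw [← J_comm hq hp' hqp.compl]; exact J_nonpos hq p2
  have h1 : S.J p g = S.J q (S.J p g) + S.J (S.u - q) (S.J p g) := C_Jcomm hp hq hpq gq
  have h2 : S.J q g = S.J p (S.J q g) + S.J (S.u - p) (S.J q g) := C_Jcomm hq hp hqp gp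
  rw [h1, e1, h2, e2, J_comm hp hq hpq]

def IsMax (S : SpecGrp G) (g r : G) : Prop :=
  r ∈ S.P ∧ S.C g r ∧ S.J r g ≤ 0 ∧ ∀ q ∈ S.P, S.C g q → S.J q g ≤ 0 → q ≤ r

theorem IsMax.unique (h : S.IsMax g r) (h2 : S.IsMax g s) : r = s :=
  le_antisymm (h2.2.2.2 r h.1 h.2.1 h.2.2.1) (h.2.2.2 s h2.1 h2.2.1 h2.2.2.1)

theorem max_of_pos (hp : p ∈ S.P) (gp : S.C g p) (bi : ∀ q ∈ S.P, S.C g q → S.C p q)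
    (p1 : 0 ≤ S.J p g) (p2 : S.J (S.u - p) g ≤ 0) (hr : r ∈ S.P)
    (rick : ∀ q ∈ S.P, (q ≤ r ↔ (S.C (S.J p g) q ∧ S.J q (S.J p g) = 0))) :
    S.IsMax g r ∧ (∀ q ∈ S.P, S.C g q → S.C r q) ∧ S.J (S.u - r) g = S.J p g ∧
      S.IsCov (S.J p g) (S.u - r) := by
  have hp' := S.P_compl p hp
  have hr' := S.P_compl r hr
  have hcov : S.IsCov (S.J p g) (S.u - r) := by
    refine ⟨hr', fun q hq => ?_⟩
    have := rick _ (S.P_compl q hq)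
    rw [show S.u - r ≤ q ↔ S.u - q ≤ r from sub_le_comm, this]
    exact ⟨fun h => ⟨C_of_ker (S.P_compl q hq) p1 h, h⟩, fun h => h.2⟩
  have hpr : S.u - p ≤ r := by
    rw [sub_le_comm, ← hcov.2 p hp]; exact Jc_J hp g
  have e1 : S.J r (S.J p g) = 0 := by
    have := cov_ker hcov; rwa [S.cc] at this
  have e2 : S.J (S.u - r) (S.J p g) = S.J p g := cov_fix hcov p1
  have e3 : S.J r (S.J (S.u - p) g) = S.J (S.u - p) g := J_of_le hr hp' hpr g
  have e4 : S.J (S.u - r) (S.J (S.u - p) g) = 0 :=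
    J_of_orth hr' hp' (by rw [S.cc]; exact hpr) g
  have gp' : g = S.J p g + S.J (S.u - p) g := gp
  have f1 : S.J r g = S.J (S.u - p) g := by
    conv_lhs => rw [gp', map_add, e1, e3, zero_add]
  have f2 : S.J (S.u - r) g = S.J p g := by
    conv_lhs => rw [gp', map_add, e2, e4, add_zero]
  refine ⟨⟨hr, ?_, ?_, ?_⟩, ?_, f2, hcov⟩
  · unfold C; rw [f1, f2, add_comm]; exact gp
  · rw [f1]; exact p2
  · intro q hq gq h
    rw [rick q hq]
    refine ⟨C_Jcomm hp hq (bi q hq gq) gq, le_antisymm ?_ (J_nonneg hq p1)⟩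
    rw [← J_comm hp hq (bi q hq gq)]
    exact J_nonpos hp h
  · intro q hq gq
    have := cov_C p1 hcov hq (C_Jcomm hp hq (bi q hq gq) gq)
    have h2 := (C_u hq).sub this
    rwa [S.cc] at h2

theorem R_exists (S : SpecGrp G) (g : G) : ∃ r, S.IsMax g r ∧ (∀ q ∈ S.P, S.C g q → S.C r q) ∧
    0 ≤ S.J (S.u - r) g ∧ S.IsCov (S.J (S.u - r) g) (S.u - r) := by
  obtain ⟨p, hp, gp, bi, p2, p1⟩ := S.gencomp g
  obtain ⟨r, hr, rick⟩ := S.rickart (S.J p g)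
  obtain ⟨h1, h2, h3, h4⟩ := max_of_pos (S := S) hp gp bi p1 p2 hr rick
  exact ⟨r, h1, h2, by rwa [h3], by rwa [h3]⟩

noncomputable def R (S : SpecGrp G) (g : G) : G := (S.R_exists g).choose

theorem R_isMax (S : SpecGrp G) (g : G) : S.IsMax g (S.R g) := (S.R_exists g).choose_spec.1
theorem R_P (S : SpecGrp G) (g : G) : S.R g ∈ S.P := (S.R_isMax g).1
theorem R_C (S : SpecGrp G) (g : G) : S.C g (S.R g) := (S.R_isMax g).2.1
theorem R_neg (S : SpecGrp G) (g : G) : S.J (S.R g) g ≤ 0 := (S.R_isMax g).2.2.1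
theorem R_max (S : SpecGrp G) (g : G) (hq : q ∈ S.P) (h : S.C g q) (h2 : S.J q g ≤ 0) :
    q ≤ S.R g := (S.R_isMax g).2.2.2 q hq h h2
theorem R_bi (S : SpecGrp G) (g : G) (hq : q ∈ S.P) (h : S.C g q) : S.C (S.R g) q :=
  (S.R_exists g).choose_spec.2.1 q hq h
theorem R_pos (S : SpecGrp G) (g : G) : 0 ≤ S.J (S.u - S.R g) g :=
  (S.R_exists g).choose_spec.2.2.1
theorem R_cov (S : SpecGrp G) (g : G) : S.IsCov (S.J (S.u - S.R g) g) (S.u - S.R g) :=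
  (S.R_exists g).choose_spec.2.2.2

theorem IsMax.smul (h : S.IsMax g r) {n : ℚ} (hn : 0 < n) : S.IsMax (n • g) r := by
  obtain ⟨h1, h2, h3, h4⟩ := h
  refine ⟨h1, h2.smul n, ?_, ?_⟩
  · rw [map_smul]; exact smul_nonpos_of_nonneg_of_nonpos hn.le h3
  · intro q hq hc hj
    have hn' : (0:ℚ) ≤ n⁻¹ := by positivity
    refine h4 q hq ?_ ?_
    · have := hc.smul n⁻¹
      rwa [smul_smul, inv_mul_cancel₀ hn.ne', one_smul] at this
    · have := smul_nonpos_of_nonneg_of_nonpos hn' hj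
      rwa [map_smul, smul_smul, inv_mul_cancel₀ hn.ne', one_smul] at this

/-! the spectral resolution -/

noncomputable def Rl (S : SpecGrp G) (a : G) (l : ℚ) : G := S.R (a - l • S.u)

variable {a b : G} {l m : ℚ}

theorem C_shift (hq : q ∈ S.P) (l : ℚ) : S.C (a - l • S.u) q ↔ S.C a q := by
  constructor
  · intro h
    have := h.add ((C_u hq).smul l)
    simpa using this
  · intro h; exact h.sub ((C_u hq).smul l)

theorem Rl_P (S : SpecGrp G) (a : G) (l : ℚ) : S.Rl a l ∈ S.P := S.R_P _

theorem Rl_C (S : SpecGrp G) (a : G) (l : ℚ) : S.C a (S.Rl a l) :=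
  (C_shift (S.Rl_P a l) l).1 (S.R_C _)

theorem Rl_bi (hq : q ∈ S.P) (h : S.C a q) (l : ℚ) : S.C (S.Rl a l) q :=
  S.R_bi _ hq ((C_shift hq l).2 h)

theorem Rl_mono (S : SpecGrp G) (a : G) (h : l ≤ m) : S.Rl a l ≤ S.Rl a m := by
  refine S.R_max _ (S.Rl_P a l) ((C_shift (S.Rl_P a l) m).2 (S.Rl_C a l)) ?_
  refine le_trans (S.J_mono _ (S.Rl_P a l) _ _ ?_) (S.R_neg (a - l • S.u))
  exact sub_le_sub_left (smul_le_smul_of_nonneg_right h S.u_nonneg) _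

theorem Rl_one (ha : a ≤ S.u) (hl : 1 ≤ l) : S.Rl a l = S.u := by
  have hu : S.u ∈ S.P := by simpa using S.P_compl 0 S.P_zero
  refine le_antisymm (S.P_le _ (S.Rl_P a l)) ?_
  have h1 : a ≤ l • S.u := ha.trans (by
    have := smul_le_smul_of_nonneg_right hl S.u_nonneg
    rwa [one_smul] at this)
  refine S.R_max _ hu ?_ (J_nonpos hu (sub_nonpos.2 h1))
  have h0 : S.C (a - l • S.u) 0 := by
    unfold C
    have e0 : ∀ x, S.J 0 x = 0 := fun x => by
      have := J_of_orth S.P_zero S.P_zero (by simpa using S.u_nonneg) x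
      rwa [J_J S.P_zero] at this
    have := S.ext_pos (S.J (S.u - 0)) LinearMap.id (fun x hx => J_ker S.P_zero hx (e0 x))
    rw [e0, this]; simp
  simpa using h0.compl

theorem Rl_zero_cov (ha : 0 ≤ a) : S.J (S.Rl a 0) a = 0 ∧ S.IsCov a (S.u - S.Rl a 0) := by
  have h0 : a - (0:ℚ) • S.u = a := by simp
  have h1 : S.J (S.Rl a 0) a = 0 := by
    refine le_antisymm ?_ (J_nonneg (S.Rl_P a 0) ha)
    have := S.R_neg (a - (0:ℚ) • S.u)
    unfold Rl
    rw [h0] at this ⊢; exact this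
  refine ⟨h1, ?_⟩
  have h2 := S.R_cov (a - (0:ℚ) • S.u)
  change S.IsCov (S.J (S.u - S.Rl a 0) (a - (0:ℚ) • S.u)) (S.u - S.Rl a 0) at h2
  rw [h0, J_ker (S.Rl_P a 0) ha h1] at h2
  exact h2

theorem diff_P (S : SpecGrp G) (a : G) (h : l ≤ m) : S.Rl a m - S.Rl a l ∈ S.P :=
  P_sub (S.Rl_P a m) (S.Rl_P a l) (S.Rl_mono a h)

theorem diff_J (S : SpecGrp G) (a : G) (h : l ≤ m) :
    S.J (S.Rl a m - S.Rl a l) a = S.J (S.Rl a m) a - S.J (S.Rl a l) a := by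
  rw [J_sub (S.Rl_P a m) (S.Rl_P a l) (S.Rl_mono a h)]
  have h1 : a = S.J (S.Rl a l) a + S.J (S.u - S.Rl a l) a := S.Rl_C a l
  have h2 : S.J (S.u - S.Rl a l) a = a - S.J (S.Rl a l) a := by
    rw [eq_sub_iff_add_eq, add_comm]; exact h1.symm
  rw [h2, map_sub, J_of_le (S.Rl_P a m) (S.Rl_P a l) (S.Rl_mono a h)]

theorem diff_le (S : SpecGrp G) (a : G) (h : l ≤ m) :
    S.J (S.Rl a m - S.Rl a l) a ≤ m • (S.Rl a m - S.Rl a l) := by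
  have h1 : S.J (S.Rl a m - S.Rl a l) (a - m • S.u) ≤ 0 := by
    rw [J_sub' (S.Rl_P a m) (S.Rl_P a l) (S.Rl_mono a h)]
    exact J_nonpos (S.P_compl _ (S.Rl_P a l)) (S.R_neg (a - m • S.u))
  rw [map_sub, map_smul, S.J_unit _ (S.diff_P a h)] at h1
  exact sub_nonpos.1 h1

theorem le_diff (S : SpecGrp G) (a : G) (h : l ≤ m) :
    l • (S.Rl a m - S.Rl a l) ≤ S.J (S.Rl a m - S.Rl a l) a := by
  have h1 : 0 ≤ S.J (S.Rl a m - S.Rl a l) (a - l • S.u) := by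
    rw [J_sub (S.Rl_P a m) (S.Rl_P a l) (S.Rl_mono a h)]
    exact J_nonneg (S.Rl_P a m) (S.R_pos (a - l • S.u))
  rw [map_sub, map_smul, S.J_unit _ (S.diff_P a h)] at h1
  exact sub_nonneg.1 h1

/-- the meet of `R_m` and the complement of `R_l` is the difference. -/
theorem diff_meet (hp : p ∈ S.P) (hq : q ∈ S.P) (hqp : q ≤ p) (hs : s ∈ S.P)
    (h1 : s ≤ p) (h2 : s ≤ S.u - q) : s ≤ p - q := by
  have := sup_le hp (S.P_nonneg s hs) (S.P_nonneg q hq) h1 hqp (by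
    linear_combination (norm := exact le_of_eq (by module)) h2)
  exact le_sub_iff_add_le.2 this

theorem approx (ha0 : 0 ≤ a) (ha : a ≤ S.u) (N : ℕ) (hN : 0 < N) :
    0 ≤ a - ∑ k ∈ Finset.range N, ((k : ℚ) / N) •
      (S.Rl a ((k + 1 : ℚ) / N) - S.Rl a ((k : ℚ) / N)) ∧
    a - ∑ k ∈ Finset.range N, ((k : ℚ) / N) •
      (S.Rl a ((k + 1 : ℚ) / N) - S.Rl a ((k : ℚ) / N)) ≤ (1 / N : ℚ) • S.u := by
  have hN' : (0 : ℚ) < N := by exact_mod_cast hN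
  have hlm : ∀ k : ℕ, (k : ℚ) / N ≤ (k + 1 : ℚ) / N := fun k => by gcongr; linarith
  have hsum : a = ∑ k ∈ Finset.range N, S.J (S.Rl a ((k + 1 : ℚ) / N) - S.Rl a ((k : ℚ) / N)) a := by
    have h1 : ∀ k ∈ Finset.range N, S.J (S.Rl a ((k + 1 : ℚ) / N) - S.Rl a ((k : ℚ) / N)) a =
      S.J (S.Rl a (((k + 1 : ℕ) : ℚ) / N)) a - S.J (S.Rl a ((k : ℚ) / N)) a := fun k _ => by
        rw [S.diff_J a (hlm k)]; push_cast; rfl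
    rw [Finset.sum_congr rfl h1,
      Finset.sum_range_sub (fun k : ℕ => S.J (S.Rl a ((k : ℚ) / N)) a)]
    rw [div_self hN'.ne', Rl_one ha le_rfl]
    simp only [Nat.cast_zero, zero_div, (Rl_zero_cov (S := S) ha0).1, sub_zero]
    have hu : S.u ∈ S.P := by simpa using S.P_compl 0 S.P_zero
    exact (S.J_fix1 _ hu a ha0 ha).symm
  have htot : ∑ k ∈ Finset.range N, (S.Rl a ((k + 1 : ℚ) / N) - S.Rl a ((k : ℚ) / N)) ≤ S.u := by
    have := Finset.sum_range_sub (fun k : ℕ => S.Rl a ((k : ℚ) / N)) N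
    push_cast at this
    rw [this, div_self hN'.ne', Rl_one ha le_rfl]
    exact sub_le_self _ (S.P_nonneg _ (S.Rl_P _ _))
  have hd : a - ∑ k ∈ Finset.range N, ((k : ℚ) / N) •
      (S.Rl a ((k + 1 : ℚ) / N) - S.Rl a ((k : ℚ) / N)) =
      ∑ k ∈ Finset.range N, (S.J (S.Rl a ((k + 1 : ℚ) / N) - S.Rl a ((k : ℚ) / N)) a -
       ((k : ℚ) / N) • (S.Rl a ((k + 1 : ℚ) / N) - S.Rl a ((k : ℚ) / N))) := by
    rw [Finset.sum_sub_distrib, ← hsum]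
  rw [hd]
  constructor
  · exact Finset.sum_nonneg fun k _ => sub_nonneg.2 (S.le_diff a (hlm k))
  · refine le_trans (Finset.sum_le_sum (g := fun k : ℕ => (1 / N : ℚ) •
      (S.Rl a ((k + 1 : ℚ) / N) - S.Rl a ((k : ℚ) / N))) fun k _ => ?_) ?_
    · have := S.diff_le a (hlm k)
      have e : ((k + 1 : ℚ) / N) = (k : ℚ) / N + 1 / N := by ring
      rw [sub_le_iff_le_add, ← add_smul, add_comm (1 / N : ℚ), ← e]
      exact this
    · rw [← Finset.smul_sum]
      exact smul_le_smul_of_nonneg_left htot (by positivity)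

theorem arch' (hx : 0 ≤ x) (h : ∀ n : ℕ, x ≤ ((1:ℚ) / 2 ^ n) • S.u) : x = 0 := by
  refine S.arch x hx fun n => ?_
  have h1 : (n : ℚ) ≤ 2 ^ n := by exact_mod_cast Nat.lt_two_pow_self.le
  have h2 := smul_le_smul_of_nonneg_left (h n) (a := (2:ℚ)^n) (by positivity)
  rw [smul_smul, mul_one_div_cancel (by positivity), one_smul] at h2
  rw [← Nat.cast_smul_eq_nsmul ℚ]
  exact (smul_le_smul_of_nonneg_right h1 hx).trans h2

/-- two-sided version. -/
theorem arch2 (h1 : ∀ n : ℕ, x ≤ ((1:ℚ) / 2 ^ n) • S.u)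
    (h2 : ∀ n : ℕ, -x ≤ ((1:ℚ) / 2 ^ n) • S.u) : x = 0 := by
  have hx : S.C x (S.R x) := S.R_C x
  have hr := S.R_P x
  have hr' := S.P_compl _ hr
  have e1 : S.J (S.u - S.R x) x = 0 := by
    refine arch' (S := S) (S.R_pos x) fun n => ?_
    exact (J_le_smul hr' (h1 n)).trans
      (smul_le_smul_of_nonneg_left (S.P_le _ hr') (by positivity))
  have e2 : -S.J (S.R x) x = 0 := by
    refine arch' (S := S) (neg_nonneg.2 (S.R_neg x)) fun n => ?_
    rw [← map_neg]
    exact (J_le_smul hr (h2 n)).trans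
      (smul_le_smul_of_nonneg_left (S.P_le _ hr) (by positivity))
  rw [hx, e1, neg_eq_zero.1 e2, add_zero]

theorem C_of_Rl (ha0 : 0 ≤ a) (ha : a ≤ S.u) (hq : q ∈ S.P)
    (h : ∀ n k : ℕ, k ≤ 2 ^ n → S.C (S.Rl a ((k : ℚ) / 2 ^ n)) q) : S.C a q := by
  have hq' := S.P_compl q hq
  have key : ∀ n : ℕ, ∃ t : G, 0 ≤ t ∧ t ≤ ((1:ℚ) / 2 ^ n) • S.u ∧
      a - (S.J q a + S.J (S.u - q) a) = t - (S.J q t + S.J (S.u - q) t) := by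
    intro n
    obtain ⟨h1, h2⟩ := approx (S := S) ha0 ha (2 ^ n) (by positivity)
    set s := ∑ k ∈ Finset.range (2 ^ n), ((k : ℚ) / (2 ^ n : ℕ)) •
      (S.Rl a ((k + 1 : ℚ) / (2 ^ n : ℕ)) - S.Rl a ((k : ℚ) / (2 ^ n : ℕ))) with hs
    have hsC : S.C s q := by
      rw [hs]
      refine Finset.sum_induction _ (fun x => S.C x q) (fun _ _ => C.add) C_zero fun k hk => ?_
      have hk' : k < 2 ^ n := Finset.mem_range.1 hk
      have e1 := h n (k + 1) hk'
      have e2 := h n k hk'.le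
      push_cast at e1 ⊢
      exact (e1.sub e2).smul _
    refine ⟨a - s, h1, by push_cast at h2; exact h2, ?_⟩
    have hs' : s = S.J q s + S.J (S.u - q) s := hsC
    rw [map_sub, map_sub]
    linear_combination (norm := module) hs'
  have hb : ∀ n : ℕ, ∀ t : G, t ≤ ((1:ℚ) / 2 ^ n) • S.u →
      S.J q t + S.J (S.u - q) t ≤ ((1:ℚ) / 2 ^ n) • S.u := by
    intro n t ht
    have := add_le_add (J_le_smul hq ht) (J_le_smul hq' ht)
    refine this.trans (le_of_eq (by module))
  have : a - (S.J q a + S.J (S.u - q) a) = 0 := by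
    refine arch2 (S := S) (fun n => ?_) (fun n => ?_)
    · obtain ⟨t, t0, t1, e⟩ := key n
      rw [e]
      exact (sub_le_self _ (add_nonneg (J_nonneg hq t0) (J_nonneg hq' t0))).trans t1
    · obtain ⟨t, t0, t1, e⟩ := key n
      rw [e, neg_sub]
      exact (sub_le_self _ t0).trans (hb n t t1)
  exact sub_eq_zero.1 this

theorem eq_of_Rl (ha0 : 0 ≤ a) (ha : a ≤ S.u) (hb0 : 0 ≤ b) (hb : b ≤ S.u)
    (h : ∀ n k : ℕ, k ≤ 2 ^ n → S.Rl a ((k : ℚ) / 2 ^ n) = S.Rl b ((k : ℚ) / 2 ^ n)) :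
    a = b := by
  rw [← sub_eq_zero]
  have key : ∀ n : ℕ, ∃ s : G, (0 ≤ a - s ∧ a - s ≤ ((1:ℚ) / 2 ^ n) • S.u) ∧
     (0 ≤ b - s ∧ b - s ≤ ((1:ℚ) / 2 ^ n) • S.u) := by
    intro n
    have h1 := approx (S := S) ha0 ha (2 ^ n) (by positivity)
    have h2 := approx (S := S) hb0 hb (2 ^ n) (by positivity)
    push_cast at h1 h2
    refine ⟨_, h1, ?_⟩
    convert h2 using 3 <;>
    · refine Finset.sum_congr rfl fun k hk => ?_
      have hk' : k < 2 ^ n := Finset.mem_range.1 hk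
      have e1 := h n (k + 1) hk'
      have e2 := h n k hk'.le
      push_cast at e1
      rw [e1, e2]
  refine arch2 (S := S) (fun n => ?_) (fun n => ?_)
  · obtain ⟨s, ⟨h1, h2⟩, h3, h4⟩ := key n
    linear_combination (norm := exact le_of_eq (by module)) h2 + h3
  · obtain ⟨s, ⟨h1, h2⟩, h3, h4⟩ := key n
    linear_combination (norm := exact le_of_eq (by module)) h4 + h1

/-- right continuity -/
theorem Rl_inf (ht : t ∈ S.P)
    (h : ∀ n : ℕ, ∃ m : ℚ, l ≤ m ∧ m ≤ l + 1 / 2 ^ n ∧ t ≤ S.Rl a m) :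
    t ≤ S.Rl a l := by
  have hr := S.Rl_P a l
  have hr' := S.P_compl _ hr
  have h0 := S.R_pos (a - l • S.u)
  change 0 ≤ S.J (S.u - S.Rl a l) (a - l • S.u) at h0
  have hcov := S.R_cov (a - l • S.u)
  change S.IsCov (S.J (S.u - S.Rl a l) (a - l • S.u)) (S.u - S.Rl a l) at hcov
  suffices hs : S.J t (S.J (S.u - S.Rl a l) (a - l • S.u)) = 0 by
    have := (hcov.2 _ (S.P_compl t ht)).1 (by rwa [S.cc])
    exact (sub_le_sub_iff_left _).1 this
  refine arch' (S := S) (J_nonneg ht h0) fun n => ?_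
  obtain ⟨m, hlm, hm, htm⟩ := h n
  have hrm := S.Rl_P a m
  have hrm' := S.P_compl _ hrm
  -- split off the part above `m`
  have hC : S.C (S.J (S.u - S.Rl a l) (a - l • S.u)) (S.Rl a m) :=
    C_Jcomm hr' hrm ((C_u hrm).sub (C_le hrm (S.P_nonneg _ hr) (S.Rl_mono a hlm)))
      ((C_shift hrm l).2 (S.Rl_C a m))
  have hC' := congrArg (S.J t) hC
  rw [map_add, J_of_orth ht hrm' (by exact sub_le_sub_left htm _), add_zero,
    ← J_sub hrm hr (S.Rl_mono a hlm)] at hC'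
  rw [hC', map_sub (S.J (S.Rl a m - S.Rl a l)), map_smul, S.J_unit _ (S.diff_P a hlm)]
  have h3 : S.J (S.Rl a m - S.Rl a l) a - l • (S.Rl a m - S.Rl a l) ≤ ((1:ℚ) / 2 ^ n) • S.u := by
    have h4 := S.diff_le a hlm
    have h5 : (m - l) • (S.Rl a m - S.Rl a l) ≤ (m - l) • S.u :=
      smul_le_smul_of_nonneg_left (S.P_le _ (S.diff_P a hlm)) (sub_nonneg.2 hlm)
    have h6 : (m - l) • S.u ≤ ((1:ℚ) / 2 ^ n) • S.u :=
      smul_le_smul_of_nonneg_right (by linarith) S.u_nonneg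
    linear_combination (norm := exact le_of_eq (by module)) h4 + h5 + h6
  exact (J_le_smul ht h3).trans
    (smul_le_smul_of_nonneg_left (S.P_le _ ht) (by positivity))

/-- The cover of the truncated positive part. -/
theorem cov_step {v : ℚ} (hmv : m < v) {N : ℚ} (hN : 0 < N) :
    S.IsCov (N • (S.J (S.Rl a v - S.Rl a m) a - m • (S.Rl a v - S.Rl a m)))
      (S.Rl a v - S.Rl a m) := by
  have hm := S.Rl_P a m
  have hv := S.Rl_P a v
  have he := S.diff_P a hmv.le
  set e := S.Rl a v - S.Rl a m with hedef
  have hd0 : 0 ≤ N • (S.J e a - m • e) :=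
    smul_nonneg hN.le (sub_nonneg.2 (S.le_diff a hmv.le))
  have hdJ : N • (S.J e a - m • e) = N • S.J e (a - m • S.u) := by
    rw [map_sub, map_smul, S.J_unit e he]
  obtain ⟨r, hr⟩ := cov_exists (S := S) hd0
  have hre : r ≤ e := by
    refine (hr.2 e he).1 ?_
    rw [hdJ, map_smul, Jc_J he, smul_zero]
  suffices h : e ≤ r by
    rw [le_antisymm hre h] at hr; exact hr
  have hv' := S.P_compl _ hv
  have hsum : r + (S.u - S.Rl a v) ≤ S.u := by
    have := S.P_nonneg _ hm
    linear_combination (norm := exact le_of_eq (by module)) hre + this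
  have hP := S.P_add r hr.1 _ hv' hsum
  have hP' := S.P_compl _ hP
  have hcov := S.R_cov (a - m • S.u)
  change S.IsCov (S.J (S.u - S.Rl a m) (a - m • S.u)) (S.u - S.Rl a m) at hcov
  have hm' := S.P_compl _ hm
  have hC : S.C (S.J (S.u - S.Rl a m) (a - m • S.u)) (S.Rl a v) :=
    C_Jcomm hm' hv ((C_u hv).sub (C_le hv (S.P_nonneg _ hm) (S.Rl_mono a hmv.le)))
      ((C_shift hv m).2 (S.Rl_C a v))
  have hC2 : S.J (S.u - S.Rl a m) (a - m • S.u) = S.J e (a - m • S.u) +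
      S.J (S.u - S.Rl a v) (S.J (S.u - S.Rl a m) (a - m • S.u)) := by
    rw [hedef, J_sub hv hm (S.Rl_mono a hmv.le)]; exact hC
  have hfix : S.J r (S.J e (a - m • S.u)) = S.J e (a - m • S.u) := by
    have := cov_fix hr hd0
    rw [hdJ, map_smul] at this
    have := congrArg (fun y => N⁻¹ • y) this
    simpa [smul_smul, inv_mul_cancel₀ hN.ne'] using this
  have h1 : S.u - S.Rl a m ≤ r + (S.u - S.Rl a v) := by
    refine (hcov.2 _ hP).1 ?_
    rw [hC2, map_add, ← hfix, J_of_orth hP' hr.1, J_of_orth hP' hv', add_zero]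
    · rw [S.cc]; exact le_add_of_nonneg_left (S.P_nonneg _ hr.1)
    · rw [S.cc]; exact le_add_of_nonneg_right (S.P_nonneg _ hv')
  rw [hedef]
  linear_combination (norm := exact le_of_eq (by module)) h1

theorem C_of_rel (hp : p ∈ S.P) (hq : q ∈ S.P) (hpq : p ≤ q)
    (h : x = S.J p x + S.J (q - p) x) : S.C x p ∧ S.J (S.u - p) x = S.J (q - p) x := by
  have hs := P_sub hq hp hpq
  have h2 : S.J (S.u - p) x = S.J (q - p) x := by
    conv_lhs => rw [h]
    rw [map_add, Jc_J hp, zero_add,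
      J_of_le (S.P_compl p hp) hs (sub_le_sub_right (S.P_le q hq) _)]
  exact ⟨by unfold C; rw [h2]; exact h, h2⟩

/-- uniqueness of the relative positive part. -/
theorem rel_unique {p₁ p₂ : G} (hq : q ∈ S.P)
    (hp₁ : p₁ ∈ S.P) (hpq₁ : p₁ ≤ q) (h₁ : g = S.J p₁ g + S.J (q - p₁) g)
    (pos₁ : 0 ≤ S.J p₁ g) (neg₁ : S.J (q - p₁) g ≤ 0)
    (hp₂ : p₂ ∈ S.P) (hpq₂ : p₂ ≤ q) (h₂ : g = S.J p₂ g + S.J (q - p₂) g)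
    (pos₂ : 0 ≤ S.J p₂ g) (neg₂ : S.J (q - p₂) g ≤ 0) : S.J p₁ g = S.J p₂ g := by
  have key : ∀ p : G, p ∈ S.P → p ≤ q → g = S.J p g + S.J (q - p) g →
      0 ≤ S.J p g → S.J (q - p) g ≤ 0 → S.J p g = S.J (S.u - S.R g) g := by
    intro p hp hpq h pos neg
    obtain ⟨c, e⟩ := C_of_rel hp hq hpq h
    have hR := S.R_P g
    have hR' := S.P_compl _ hR
    have hc : S.C (S.u - S.R g) p := (C_u hp).sub (S.R_bi g hp c)
    refine posp_unique hp hR' c (S.R_C g).compl (hc.symm hR' hp) pos (by rwa [e]) (S.R_pos g) ?_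
    rw [S.cc]; exact S.R_neg g
  rw [key p₁ hp₁ hpq₁ h₁ pos₁ neg₁, key p₂ hp₂ hpq₂ h₂ pos₂ neg₂]

theorem rel_exists {c : G} (hq : q ∈ S.P) (hc0 : 0 ≤ c) (hcq : c ≤ q) :
    ∃ p ∈ S.P, p ≤ q ∧ c = S.J p c + S.J (q - p) c ∧
      (∀ r ∈ S.P, r ≤ q → c = S.J r c + S.J (q - r) c → r = S.J p r + S.J (q - p) r) ∧
      0 ≤ S.J p (c - (q - c)) ∧ S.J (q - p) (c - (q - c)) ≤ 0 := by
  obtain ⟨p, hp, gp, bi, neg, pos⟩ := S.gencomp (c - (q - c))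
  have hp' := S.P_compl p hp
  have hcC : S.C c q := C_le hq hc0 hcq
  have hqq : S.C q q := C_le hq (S.P_nonneg q hq) le_rfl
  have hpq : S.C p q := bi q hq (hcC.sub (hqq.sub hcC))
  have hqp : S.C q p := hpq.symm hp hq
  obtain ⟨hr, hJr⟩ := meet_eq hq hp hqp
  obtain ⟨hs, hJs⟩ := meet_eq hq hp' hqp.compl
  have es : q - S.J q p = S.J q (S.u - p) := by rw [map_sub, S.J_unit q hq]
  have hcp : S.C c p := by
    have h1 : S.C (c - (q - c)) p := gp
    have := (h1.add hqp).smul (1/2)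
    convert this using 1
    module
  have hJq : ∀ x, 0 ≤ x → x ≤ q → S.C x p → x = S.J (S.J q p) x + S.J (q - S.J q p) x := by
    intro x hx0 hx hxp
    rw [es, ← hJr, ← hJs, ← map_add]
    have hxp' : x = S.J p x + S.J (S.u - p) x := hxp
    rw [← hxp', S.J_fix1 q hq x hx0 hx]
  refine ⟨S.J q p, hr, J_le_self hq (S.P_le p hp), hJq c hc0 hcq hcp, ?_, ?_, ?_⟩
  · intro r hr hrq h
    refine hJq r (S.P_nonneg r hr) hrq ?_
    have h1 : S.C c r := (C_of_rel hr hq hrq h).1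
    have h2 : S.C q r := C_P_le hq hr hrq
    exact C.symm (bi r hr (h1.sub (h2.sub h1))) hp hr
  · rw [← hJr]; exact J_nonneg hq pos
  · rw [es, ← hJs]; exact J_nonpos hq neg

/-- the recursion step of the binary resolution. -/
theorem step_pos {v N : ℚ} (hlm : l ≤ m) (hmv : m ≤ v) (hN : 0 ≤ N)
    (hg : g = N • (S.J (S.Rl a v - S.Rl a l) a - m • (S.Rl a v - S.Rl a l)))
    (hp : p ∈ S.P) (hpq : p ≤ S.Rl a v - S.Rl a l)
    (h : g = S.J p g + S.J (S.Rl a v - S.Rl a l - p) g)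
    (pos : 0 ≤ S.J p g) (neg : S.J (S.Rl a v - S.Rl a l - p) g ≤ 0) :
    S.J p g = N • (S.J (S.Rl a v - S.Rl a m) a - m • (S.Rl a v - S.Rl a m)) := by
  have he1 := S.diff_P a hmv
  have he0 := S.diff_P a hlm
  have hq := S.diff_P a (hlm.trans hmv)
  set e1 := S.Rl a v - S.Rl a m with e1def
  set e0 := S.Rl a m - S.Rl a l with e0def
  set q := S.Rl a v - S.Rl a l with qdef
  have hqe : q = e1 + e0 := by rw [qdef, e1def, e0def]; abel
  have hqJ : S.J q a = S.J e1 a + S.J e0 a := by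
    rw [qdef, e1def, e0def, S.diff_J a hmv, S.diff_J a hlm, S.diff_J a (hlm.trans hmv)]; abel
  have h10 : e0 ≤ S.u - e1 := by
    have := S.P_le q hq
    linear_combination (norm := exact le_of_eq (by module)) this + hqe.symm.le
  have h01 : e1 ≤ S.u - e0 := by
    have := S.P_le q hq
    linear_combination (norm := exact le_of_eq (by module)) this + hqe.symm.le
  have g1 : S.J e1 g = N • (S.J e1 a - m • e1) := by
    have : S.J e1 e0 = 0 := by
      have := J_of_orth he1 he0 h10 S.u
      rwa [S.J_unit e0 he0] at this
    rw [hg, hqJ, hqe, map_smul, map_sub, map_smul, map_add, map_add, J_J he1,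
      J_of_orth he1 he0 h10, J_self he1, this]
    simp
  have g0 : S.J e0 g = N • (S.J e0 a - m • e0) := by
    have : S.J e0 e1 = 0 := by
      have := J_of_orth he0 he1 h01 S.u
      rwa [S.J_unit e1 he1] at this
    rw [hg, hqJ, hqe, map_smul, map_sub, map_smul, map_add, map_add, J_J he0,
      J_of_orth he0 he1 h01, J_self he0, this]
    simp
  have hqe' : q - e1 = e0 := by rw [hqe]; abel
  rw [← g1]
  refine rel_unique hq hp hpq h pos neg he1 ?_ ?_ ?_ ?_
  · rw [hqe]; exact le_add_of_nonneg_right (S.P_nonneg e0 he0)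
  · rw [hqe', g1, g0, hg, hqJ, hqe]; module
  · rw [g1]; exact smul_nonneg hN (sub_nonneg.2 (S.le_diff a hmv))
  · rw [hqe', g0]
    exact smul_nonpos_of_nonneg_of_nonpos hN (sub_nonpos.2 (S.diff_le a hlm))

end SpecGrp

/-! ### Translating effect-algebra notions into the group -/

namespace EffectAlgebra

/-- `φ` identifies the effect algebra with the interval `[0,v]`. -/
structure Emb {E : Type u} (EA : EffectAlgebra E) {G : Type u} [AddCommGroup G]
    [PartialOrder G] (φ : E → G) (v : G) : Prop where
  one : φ EA.one = v
  nn : ∀ a, 0 ≤ φ a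
  le1 : ∀ a, φ a ≤ v
  inj : Function.Injective φ
  surj : ∀ g : G, 0 ≤ g → g ≤ v → ∃ a : E, φ a = g
  padd : ∀ a b c : E, (EA.padd a b = some c ↔ φ a + φ b ≤ v ∧ φ c = φ a + φ b)

namespace Emb

variable {E : Type u} {EA : EffectAlgebra E} {G : Type u} [AddCommGroup G]
    [PartialOrder G] [IsOrderedAddMonoid G] {φ : E → G} {v : G}


theorem zero (H : Emb EA φ v) : φ EA.zero = 0 := by
  have hv : 0 ≤ v := H.one ▸ H.nn EA.one
  obtain ⟨a, ha⟩ := H.surj 0 le_rfl hv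
  have : EA.padd a EA.one = some EA.one := by
    rw [H.padd, ha, H.one, zero_add]; exact ⟨le_rfl, rfl⟩
  rw [← EA.add_one _ _ this, ha]

theorem compl (H : Emb EA φ v) (a : E) : φ (EA.compl a) = v - φ a := by
  have := (EA.orth_exists a).choose_spec
  rw [H.padd, H.one] at this
  rw [this.2]; unfold EffectAlgebra.compl; abel

theorem cc (H : Emb EA φ v) (a : E) : EA.compl (EA.compl a) = a := by
  apply H.inj; rw [H.compl, H.compl]; abel

theorem le_iff (H : Emb EA φ v) (a b : E) : EA.le a b ↔ φ a ≤ φ b := by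
  constructor
  · rintro ⟨c, hc⟩
    rw [H.padd] at hc
    rw [hc.2]; exact le_add_of_nonneg_right (H.nn c)
  · intro h
    obtain ⟨c, hc⟩ := H.surj (φ b - φ a) (sub_nonneg.2 h)
      ((sub_le_self _ (H.nn a)).trans (H.le1 b))
    refine ⟨c, (H.padd _ _ _).2 ?_⟩
    have e : φ a + φ c = φ b := by rw [hc]; abel
    rw [e]; exact ⟨H.le1 b, rfl⟩

theorem osub (H : Emb EA φ v) {a b : E} (h : φ a ≤ φ b) : φ (EA.osub b a) = φ b - φ a := by
  have h' : ∃ c, EA.padd a c = some b := (H.le_iff a b).2 h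
  unfold EffectAlgebra.osub
  rw [dif_pos h']
  have := h'.choose_spec
  rw [H.padd] at this
  rw [this.2]; abel

theorem oplusD (H : Emb EA φ v) {a b : E} (h : φ a + φ b ≤ v) : φ (EA.oplusD a b) = φ a + φ b := by
  obtain ⟨c, hc⟩ := H.surj (φ a + φ b) (add_nonneg (H.nn a) (H.nn b)) h
  have : EA.padd a b = some c := by rw [H.padd, hc]; exact ⟨h, rfl⟩
  unfold EffectAlgebra.oplusD
  rw [this]; simpa using hc

theorem padd_iff (H : Emb EA φ v) (a b c : E) : EA.padd a b = some c ↔ φ c = φ a + φ b := by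
  rw [H.padd]
  exact ⟨fun h => h.2, fun h => ⟨h ▸ H.le1 c, h⟩⟩

theorem nsmul_eq (H : Emb EA φ v) (n : ℕ) (x a : E) (h : EA.nsmulE n x = some a) : φ a = n • φ x := by
  induction n generalizing a with
  | zero =>
    simp only [nsmulE, Option.some.injEq] at h
    rw [← h, H.zero, zero_smul]
  | succ n ih =>
    simp only [nsmulE, Option.bind_eq_some_iff] at h
    obtain ⟨b, hb, h⟩ := h
    rw [H.padd_iff, ih b hb] at h
    rw [h, succ_nsmul, add_comm]

theorem nsmul_def (H : Emb EA φ v) (n : ℕ) (x : E) (h : n • φ x ≤ v) : ∃ a, EA.nsmulE n x = some a := by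
  induction n with
  | zero => exact ⟨_, rfl⟩
  | succ n ih =>
    have hle : n • φ x ≤ (n + 1) • φ x := by
      rw [succ_nsmul]; exact le_add_of_nonneg_right (H.nn x)
    obtain ⟨b, hb⟩ := ih (hle.trans h)
    have e := H.nsmul_eq n x b hb
    obtain ⟨c, hc⟩ := H.surj ((n + 1) • φ x) (nsmul_nonneg (H.nn x) _) h
    refine ⟨c, ?_⟩
    simp only [nsmulE, Option.bind_eq_some_iff]
    exact ⟨b, hb, by rw [H.padd_iff, hc, e, succ_nsmul, add_comm]⟩

theorem mackey_iff (H : Emb EA φ v) (a b : E) : EA.Mackey a b ↔ ∃ x y z : G, 0 ≤ x ∧ 0 ≤ y ∧ 0 ≤ z ∧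
    x + y + z ≤ v ∧ φ a = x + z ∧ φ b = y + z := by
  constructor
  · rintro ⟨a1, b1, c, d, e, h1, h2, h3, h4⟩
    rw [H.padd_iff] at h1 h2 h3 h4
    refine ⟨φ a1, φ b1, φ c, H.nn _, H.nn _, H.nn _, ?_, h3, h4⟩
    rw [← h1, ← h2]; exact H.le1 e
  · rintro ⟨x, y, z, hx, hy, hz, h, ha, hb⟩
    have hxy : x + y ≤ v := (le_add_of_nonneg_right hz).trans h
    obtain ⟨x', hx'⟩ := H.surj x hx ((le_add_of_nonneg_right hy).trans hxy)
    obtain ⟨y', hy'⟩ := H.surj y hy ((le_add_of_nonneg_left hx).trans hxy)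
    obtain ⟨z', hz'⟩ := H.surj z hz ((le_add_of_nonneg_left (add_nonneg hx hy)).trans h)
    obtain ⟨d, hd⟩ := H.surj (x + y) (add_nonneg hx hy) hxy
    obtain ⟨e, he⟩ := H.surj (x + y + z) (add_nonneg (add_nonneg hx hy) hz) h
    refine ⟨x', y', z', d, e, ?_, ?_, ?_, ?_⟩ <;> rw [H.padd_iff] <;> simp_all

end Emb

/-- the full context. -/
structure Ctx {E : Type u} (EA : EffectAlgebra E) (CB : CompressionBase EA) {G : Type u}
    [AddCommGroup G] [PartialOrder G] [Module ℚ G] (φ : E → G) (v : G)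
    (Jt : E → G → G) : Prop extends Emb EA φ v where
  unit : ∀ g : G, ∃ n : ℕ, g ≤ n • v
  arch : EA.ArchimedeanEA
  div : ∀ a : E, ∀ n : ℕ, 0 < n → ∃ x : E, φ x = (1 / n : ℚ) • φ a
  gen : ∀ g : G, g ∈ AddSubgroup.closure (Set.range φ)
  J_add : ∀ p ∈ CB.P, ∀ x y : G, Jt p (x + y) = Jt p x + Jt p y
  J_mono : ∀ p ∈ CB.P, ∀ x y : G, x ≤ y → Jt p x ≤ Jt p y
  J_φ : ∀ p ∈ CB.P, ∀ a : E, Jt p (φ a) = φ (CB.J p a)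

namespace Ctx

variable {E : Type u} {EA : EffectAlgebra E} {CB : CompressionBase EA} {G : Type u}
    [AddCommGroup G] [PartialOrder G] [IsOrderedAddMonoid G] [Module ℚ G] {φ : E → G} {v : G}
    {Jt : E → G → G}


theorem v_nn (H : Ctx EA CB φ v Jt) : 0 ≤ v := H.one ▸ H.nn EA.one

theorem smul_nn (H : Ctx EA CB φ v Jt) {x : G} (h0 : 0 ≤ x) (h1 : x ≤ v) {r : ℚ} (hr : 0 ≤ r) : 0 ≤ r • x := by
  obtain ⟨a, rfl⟩ := H.surj x h0 h1
  obtain ⟨y, hy⟩ := H.div a r.den r.den_pos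
  have e : r • φ a = r.num.toNat • φ y := by
    rw [hy, ← Nat.cast_smul_eq_nsmul ℚ, smul_smul]
    congr 1
    have h2 : ((r.num.toNat : ℕ) : ℚ) = (r.num : ℚ) := by
      have : ((r.num.toNat : ℕ) : ℤ) = r.num := Int.toNat_of_nonneg (Rat.num_nonneg.2 hr)
      exact_mod_cast congrArg (fun z : ℤ => (z : ℚ)) this
    rw [h2, mul_one_div, Rat.num_div_den]
  rw [e]; exact nsmul_nonneg (H.nn y) _

theorem rep (H : Ctx EA CB φ v Jt) (g : G) : ∃ N : ℚ, 1 ≤ N ∧ ∃ f : E, g = N • ((2:ℚ) • φ f - v) := by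
  refine AddSubgroup.closure_induction (p := fun g _ => ∃ N : ℚ, 1 ≤ N ∧ ∃ f : E,
    g = N • ((2:ℚ) • φ f - v)) ?_ ?_ ?_ ?_ (H.gen g)
  · rintro _ ⟨a, rfl⟩
    obtain ⟨f, hf⟩ := H.surj ((1/2:ℚ) • φ a + (1/2:ℚ) • v)
      (add_nonneg (H.smul_nn (H.nn a) (H.le1 a) (by norm_num))
        (H.smul_nn H.v_nn le_rfl (by norm_num))) (by
        have := H.smul_nn (x := v - φ a) (sub_nonneg.2 (H.le1 a)) (sub_le_self _ (H.nn a))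
          (r := 1/2) (by norm_num)
        rw [← sub_nonneg]
        convert this using 1
        module)
    exact ⟨1, le_rfl, f, by rw [hf]; module⟩
  · obtain ⟨f, hf⟩ := H.surj ((1/2:ℚ) • v) (H.smul_nn H.v_nn le_rfl (by norm_num)) (by
        have := H.smul_nn (x := v) H.v_nn le_rfl (r := 1/2) (by norm_num)
        rw [← sub_nonneg]
        convert this using 1
        module)
    exact ⟨1, le_rfl, f, by rw [hf]; module⟩
  · rintro _ _ - - ⟨N, hN, f, rfl⟩ ⟨M, hM, k, rfl⟩
    have hN0 : 0 < N := by linarith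
    have hM0 : 0 < M := by linarith
    have hN1 : 1 / (4 * N) ≤ 1 / 4 := by
      rw [div_le_div_iff₀ (by positivity) (by norm_num)]; linarith
    have hM1 : 1 / (4 * M) ≤ 1 / 4 := by
      rw [div_le_div_iff₀ (by positivity) (by norm_num)]; linarith
    have hs : 0 ≤ 1 / 2 - 1 / (4 * M) - 1 / (4 * N) := by linarith
    have a1 := H.smul_nn (H.nn f) (H.le1 f) (r := 1 / (2 * M)) (by positivity)
    have a2 := H.smul_nn (H.nn k) (H.le1 k) (r := 1 / (2 * N)) (by positivity)
    have a3 := H.smul_nn H.v_nn le_rfl hs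
    have b1 := H.smul_nn (x := v - φ f) (sub_nonneg.2 (H.le1 f)) (sub_le_self _ (H.nn f))
      (r := 1 / (2 * M)) (by positivity)
    have b2 := H.smul_nn (x := v - φ k) (sub_nonneg.2 (H.le1 k)) (sub_le_self _ (H.nn k))
      (r := 1 / (2 * N)) (by positivity)
    obtain ⟨z, hz⟩ := H.surj _ (add_nonneg (add_nonneg a1 a2) a3) (by
      have := add_nonneg (add_nonneg b1 b2) a3
      rw [← sub_nonneg]
      convert this using 1
      match_scalars <;> field_simp <;> ring)
    refine ⟨2 * N * M, by nlinarith, z, ?_⟩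
    rw [hz]
    match_scalars <;> field_simp <;> ring
  · rintro _ - ⟨N, hN, f, rfl⟩
    exact ⟨N, hN, EA.compl f, by rw [H.compl]; module⟩

theorem P_compl (H : Ctx EA CB φ v Jt) {p : E} (hp : p ∈ CB.P) : EA.compl p ∈ CB.P := CB.sub.2.2.1 p hp

theorem J_map (H : Ctx EA CB φ v Jt) (p : E) (hp : p ∈ CB.P) : ∃ L : G →ₗ[ℚ] G, ∀ x, L x = Jt p x :=
  ⟨(AddMonoidHom.mk' (Jt p) (H.J_add p hp)).toRatLinearMap, fun _ => rfl⟩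

theorem J_sub (H : Ctx EA CB φ v Jt) (p : E) (hp : p ∈ CB.P) (x y : G) : Jt p (x - y) = Jt p x - Jt p y := by
  obtain ⟨L, hL⟩ := H.J_map p hp
  simp only [← hL, map_sub]

theorem J_smul (H : Ctx EA CB φ v Jt) (p : E) (hp : p ∈ CB.P) (r : ℚ) (x : G) : Jt p (r • x) = r • Jt p x := by
  obtain ⟨L, hL⟩ := H.J_map p hp
  simp only [← hL, map_smul]

theorem J_v (H : Ctx EA CB φ v Jt) (p : E) (hp : p ∈ CB.P) : Jt p v = φ p := by
  rw [← H.one, H.J_φ p hp, CB.focus p hp]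

theorem J_fix (H : Ctx EA CB φ v Jt) (p : E) (hp : p ∈ CB.P) (a : E) (h : φ a ≤ φ p) : CB.J p a = a := by
  refine (CB.compr p hp).1.2 a ?_
  rw [CB.focus p hp, H.le_iff]; exact h

theorem J_zero (H : Ctx EA CB φ v Jt) (p : E) (hp : p ∈ CB.P) (a : E) : CB.J p a = EA.zero ↔ φ a ≤ v - φ p := by
  rw [(CB.compr p hp).2 a, CB.focus p hp, H.le_iff, H.compl]

theorem inC_iff (H : Ctx EA CB φ v Jt) (a p : E) : inC EA CB a p ↔ φ a = φ (CB.J p a) + φ (CB.J (EA.compl p) a) := by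
  unfold inC; rw [H.padd_iff]

theorem inCG_iff (H : Ctx EA CB φ v Jt) (a p : E) (hp : p ∈ CB.P) : inCG EA Jt (φ a) p ↔ inC EA CB a p := by
  unfold inCG; rw [H.inC_iff, H.J_φ p hp, H.J_φ _ (H.P_compl hp)]

/-- Mackey compatible projections commute. -/
theorem inC_of_mackey (H : Ctx EA CB φ v Jt) (a p : E) (hp : p ∈ CB.P) (h : EA.Mackey a p) : inC EA CB a p := by
  rw [H.mackey_iff] at h
  obtain ⟨x, y, z, hx, hy, hz, hs, ha, hb⟩ := h
  have hp' := H.P_compl hp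
  obtain ⟨x', hx'⟩ := H.surj x hx
    (((le_add_of_nonneg_right (add_nonneg hy hz)).trans (add_assoc x y z).ge).trans hs)
  obtain ⟨z', hz'⟩ := H.surj z hz ((le_add_of_nonneg_left (add_nonneg hx hy)).trans hs)
  have hxp : φ x' ≤ v - φ p := by
    rw [hx', hb, le_sub_iff_add_le, ← add_assoc]; exact hs
  have hzp : φ z' ≤ φ p := by rw [hz', hb]; exact le_add_of_nonneg_left hy
  have hcp : v - φ (EA.compl p) = φ p := by rw [H.compl]; abel
  rw [← H.inCG_iff a p hp]
  unfold inCG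
  have e : φ a = φ x' + φ z' := by rw [hx', hz', ha]
  rw [e, H.J_add p hp, H.J_add _ hp', H.J_φ p hp, H.J_φ p hp, H.J_φ _ hp', H.J_φ _ hp',
    (H.J_zero p hp x').2 hxp, H.J_fix p hp z' hzp, (H.J_zero _ hp' z').2 (by rw [hcp]; exact hzp),
    H.J_fix _ hp' x' (by rw [H.compl]; exact hxp), H.zero]
  abel

theorem mackey_of_inC (H : Ctx EA CB φ v Jt) (a p : E) (hp : p ∈ CB.P) (h : inC EA CB a p) : EA.Mackey a p := by
  have hp' := H.P_compl hp
  rw [H.inC_iff] at h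
  rw [H.mackey_iff]
  have key : ∀ q ∈ CB.P, φ (CB.J q a) ≤ φ q := fun q hq => by
    have := H.J_mono q hq _ _ (H.le1 a)
    rwa [H.J_φ q hq, H.J_v q hq] at this
  refine ⟨φ (CB.J (EA.compl p) a), φ p - φ (CB.J p a), φ (CB.J p a), H.nn _,
    sub_nonneg.2 (key p hp), H.nn _, ?_, by rw [add_comm]; exact h, by abel⟩
  have := key _ hp'
  rw [H.compl] at this
  have e : φ (CB.J (EA.compl p) a) + (φ p - φ (CB.J p a)) + φ (CB.J p a) =
    φ (CB.J (EA.compl p) a) + φ p := by abel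
  rw [e]; exact le_sub_iff_add_le.1 this

theorem mackey_symm (H : Ctx EA CB φ v Jt) (a p : E) (h : EA.Mackey a p) : EA.Mackey p a := by
  rw [H.mackey_iff] at h ⊢
  obtain ⟨x, y, z, hx, hy, hz, hs, ha, hb⟩ := h
  exact ⟨y, x, z, hy, hx, hz, by rwa [add_comm y x], hb, ha⟩

theorem inC_symm (H : Ctx EA CB φ v Jt) (q p : E) (hq : q ∈ CB.P) (hp : p ∈ CB.P) (h : inC EA CB q p) :
    inC EA CB p q :=
  H.inC_of_mackey p q hq (H.mackey_symm _ _ (H.mackey_of_inC q p hp h))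

theorem inC_rep (H : Ctx EA CB φ v Jt) {g : G} {N : ℚ} (hN : 1 ≤ N) {f : E} (hg : g = N • ((2:ℚ) • φ f - v)) (p : E)
    (hp : p ∈ CB.P) : inCG EA Jt g p ↔ inC EA CB f p := by
  have hp' := H.P_compl hp
  rw [← H.inCG_iff f p hp]
  unfold inCG
  have hN0 : N ≠ 0 := by linarith
  have e : Jt p g + Jt (EA.compl p) g =
      N • ((2:ℚ) • (Jt p (φ f) + Jt (EA.compl p) (φ f)) - v) := by
    rw [hg, H.J_smul p hp, H.J_smul _ hp', H.J_sub p hp, H.J_sub _ hp', H.J_smul p hp,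
      H.J_smul _ hp', H.J_v p hp, H.J_v _ hp', H.compl]
    module
  rw [e]
  constructor
  · intro h
    rw [hg] at h
    have h2 := smul_right_injective G hN0 h
    have h3 := sub_left_injective h2
    exact smul_right_injective G (show (2:ℚ) ≠ 0 by norm_num) h3
  · intro h; rw [← h]; exact hg

theorem inC_compl (H : Ctx EA CB φ v Jt) (a p : E) (hp : p ∈ CB.P) : inC EA CB (EA.compl a) p ↔ inC EA CB a p := by
  have hp' := H.P_compl hp
  rw [← H.inCG_iff a p hp, ← H.inCG_iff _ p hp]
  unfold inCG
  rw [H.compl, H.J_sub p hp, H.J_sub _ hp', H.J_v p hp, H.J_v _ hp', H.compl]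
  constructor <;> intro h
  · linear_combination (norm := module) -h
  · nth_rw 1 [h]; abel

theorem gencomp (H : Ctx EA CB φ v Jt) (hS : Spectral EA CB) : GenCompG EA CB Jt φ := by
  intro g
  obtain ⟨N, hN, f, hg⟩ := H.rep g
  have hN0 : 0 ≤ N := by linarith
  have hcom : CommuteEl EA CB (EA.compl f) f := by
    intro p hp q hq
    refine H.mackey_of_inC p q hq.1.1 (hp.2 q ⟨hq.1.1, ?_⟩)
    exact (H.inC_compl f q hq.1.1).2 hq.1.2
  obtain ⟨p, ⟨hpP, hpall⟩, h1, h2⟩ := hS.2.2 _ _ hcom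
  have hp' := H.P_compl hpP
  have hfp : inC EA CB f p := hpall f (Or.inr (by simp))
  refine ⟨p, ⟨⟨hpP, (H.inC_rep hN hg p hpP).2 hfp⟩, ?_⟩, ?_, ?_⟩
  · rintro q ⟨hq, hqg⟩
    have hqf := (H.inC_rep hN hg q hq).1 hqg
    rw [H.inCG_iff p q hq]
    refine H.inC_symm q p hq hpP (hpall q (Or.inl ⟨hq, ?_⟩))
    rintro a (rfl | rfl)
    · exact (H.inC_compl f q hq).2 hqf
    · exact hqf
  · obtain ⟨c, hc⟩ := h2
    rw [H.padd_iff, ← H.J_φ _ hp', ← H.J_φ _ hp', H.compl, H.J_sub _ hp'] at hc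
    have e : Jt (EA.compl p) g = -(N • φ c) := by
      rw [hg, H.J_smul _ hp', H.J_sub _ hp', H.J_smul _ hp', ← smul_neg]
      congr 1
      linear_combination (norm := module) -hc
    rw [e]; exact neg_nonpos.2 (H.smul_nn (H.nn c) (H.le1 c) hN0)
  · obtain ⟨c, hc⟩ := h1
    rw [H.padd_iff, ← H.J_φ _ hpP, ← H.J_φ _ hpP, H.compl, H.J_sub _ hpP] at hc
    have e : Jt p g = (N • φ c) := by
      rw [hg, H.J_smul _ hpP, H.J_sub _ hpP, H.J_smul _ hpP]
      congr 1
      linear_combination (norm := module) hc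
    rw [e]; exact (H.smul_nn (H.nn c) (H.le1 c) hN0)

theorem posSMul (H : Ctx EA CB φ v Jt) (hG : GenCompG EA CB Jt φ) : PosSMulMono ℚ G := by
  have key : ∀ (n : ℕ), 0 < n → ∀ x : G, 0 ≤ n • x → 0 ≤ x := by
    intro n hn x hx
    obtain ⟨p, ⟨⟨hp, hxp⟩, -⟩, h1, h2⟩ := hG x
    have hp' := H.P_compl hp
    have hn' : (n : ℚ) ≠ 0 := by exact_mod_cast hn.ne'
    have h3 : (n : ℚ) • Jt (EA.compl p) x = 0 := by
      refine le_antisymm ?_ ?_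
      · rw [Nat.cast_smul_eq_nsmul]; exact nsmul_nonpos h1 n
      · rw [← H.J_smul _ hp', Nat.cast_smul_eq_nsmul]
        have := H.J_mono _ hp' _ _ hx
        have h0 : Jt (EA.compl p) 0 = 0 := by
          have := H.J_smul _ hp' 0 0
          simpa using this
        rwa [h0] at this
    have h4 : Jt (EA.compl p) x = 0 := (smul_eq_zero.1 h3).resolve_left hn'
    unfold inCG at hxp
    rw [hxp, h4, add_zero]; exact h2
  have key2 : ∀ (r : ℚ), 0 ≤ r → ∀ x : G, 0 ≤ x → 0 ≤ r • x := by
    intro r hr x hx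
    refine key r.den r.den_pos _ ?_
    have e : r.den • r • x = r.num.toNat • x := by
      rw [← Nat.cast_smul_eq_nsmul ℚ, ← Nat.cast_smul_eq_nsmul ℚ, smul_smul]
      congr 1
      have h2 : ((r.num.toNat : ℕ) : ℚ) = (r.num : ℚ) := by
        have : ((r.num.toNat : ℕ) : ℤ) = r.num := Int.toNat_of_nonneg (Rat.num_nonneg.2 hr)
        exact_mod_cast congrArg (fun z : ℤ => (z : ℚ)) this
      rw [h2, mul_comm, Rat.mul_den_eq_num]
    rw [e]; exact nsmul_nonneg hx _
  refine ⟨fun r hr x y hxy => ?_⟩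
  have := key2 r hr _ (sub_nonneg.2 hxy)
  rw [smul_sub] at this
  exact sub_nonneg.1 this

/-- a Rickart map gives projection covers. -/
theorem cover_of_rick (H : Ctx EA CB φ v Jt) (rick : G → E) (hr : RickartMapG EA CB Jt rick) : ProjCoverProp EA CB := by
  intro a
  obtain ⟨h1, h2⟩ := hr (φ a)
  refine ⟨EA.compl (rick (φ a)), H.P_compl h1, fun q hq => ?_⟩
  have hq' := H.P_compl hq
  have h3 := h2 _ hq'
  have e : EA.le (EA.compl (rick (φ a))) q ↔ EA.le (EA.compl q) (rick (φ a)) := by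
    rw [H.le_iff, H.le_iff, H.compl, H.compl]; exact sub_le_comm
  rw [e, h3, H.inCG_iff a _ hq', H.J_φ _ hq', ← H.zero, H.inj.eq_iff, H.J_zero _ hq', H.compl,
    H.le_iff]
  have e2 : v - (v - φ q) = φ q := by abel
  rw [e2]
  refine ⟨fun h => ⟨?_, h⟩, fun h => h.2⟩
  refine H.inC_of_mackey _ _ hq' ((H.mackey_iff _ _).2
    ⟨φ a, v - φ q, 0, H.nn _, sub_nonneg.2 (H.le1 q), le_rfl, ?_, by simp, ?_⟩)
  · rw [add_zero]
    have := add_le_add_left h (v - φ q)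
    refine this.trans (le_of_eq (by abel))
  · rw [H.compl, add_zero]

end Ctx

end EffectAlgebra

/-! ### The abstract spectral group attached to the effect algebra -/

namespace EffectAlgebra

/-- `S` is the abstract spectral group corresponding to the data. -/
structure Lk {E : Type u} (EA : EffectAlgebra E) (CB : CompressionBase EA) {G : Type u}
    [AddCommGroup G] [PartialOrder G] [IsOrderedAddMonoid G] [Module ℚ G] [PosSMulMono ℚ G]
    (φ : E → G) (v : G) (Jt : E → G → G) (S : SpecGrp G) : Prop
    extends Ctx EA CB φ v Jt where
  hu : S.u = v
  hP : ∀ g, g ∈ S.P ↔ ∃ e ∈ CB.P, φ e = g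
  hJ : ∀ p ∈ CB.P, ∀ x, S.J (φ p) x = Jt p x

section

variable {E : Type u} {EA : EffectAlgebra E} {CB : CompressionBase EA} {G : Type u}
    [AddCommGroup G] [PartialOrder G] [IsOrderedAddMonoid G] [Module ℚ G] [PosSMulMono ℚ G]
    {φ : E → G} {v : G} {Jt : E → G → G}

theorem Ctx.exists_S (H : Ctx EA CB φ v Jt) (hG : GenCompG EA CB Jt φ)
    (hC : ProjCoverProp EA CB) : ∃ S : SpecGrp G, Lk EA CB φ v Jt S := by
  have hex : ∀ g : G, ∃ L : G →ₗ[ℚ] G, ∀ p ∈ CB.P, φ p = g → ∀ x, L x = Jt p x := by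
    intro g
    by_cases h : ∃ p ∈ CB.P, φ p = g
    · obtain ⟨p, hp, rfl⟩ := h
      obtain ⟨L, hL⟩ := H.J_map p hp
      refine ⟨L, fun q _ e x => ?_⟩
      rw [H.inj e]; exact hL x
    · refine ⟨0, fun p hp e => absurd ⟨p, hp, e⟩ h⟩
  choose J hJ using hex
  have hJ' : ∀ p ∈ CB.P, ∀ x, J (φ p) x = Jt p x := fun p hp x => hJ _ p hp rfl x
  have hJc : ∀ p ∈ CB.P, ∀ x, J (v - φ p) x = Jt (EA.compl p) x := fun p hp x => by
    rw [← H.compl]; exact hJ' _ (H.P_compl hp) x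
  let S : SpecGrp G :=
  { u := v
    P := {g | ∃ e ∈ CB.P, φ e = g}
    J := J
    u_nonneg := H.v_nn
    unit := H.unit
    arch := by
      intro x hx h
      have hx1 : x ≤ v := by simpa using h 1
      obtain ⟨a, rfl⟩ := H.surj x hx hx1
      rw [H.arch a fun n => H.nsmul_def n a (h n), H.zero]
    P_zero := ⟨_, CB.sub.1, H.zero⟩
    P_compl := by
      rintro _ ⟨e, he, rfl⟩
      exact ⟨_, H.P_compl he, H.compl e⟩
    P_add := by
      rintro _ ⟨e, he, rfl⟩ _ ⟨f, hf, rfl⟩ h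
      obtain ⟨c, hc⟩ := H.surj _ (add_nonneg (H.nn e) (H.nn f)) h
      exact ⟨c, CB.sub.2.2.2 e he f hf c ((H.padd_iff _ _ _).2 hc), hc⟩
    P_nonneg := by rintro _ ⟨e, he, rfl⟩; exact H.nn e
    P_le := by rintro _ ⟨e, he, rfl⟩; exact H.le1 e
    J_mono := by
      rintro _ ⟨e, he, rfl⟩ x y h
      rw [hJ' e he, hJ' e he]; exact H.J_mono e he _ _ h
    J_unit := by
      rintro _ ⟨e, he, rfl⟩
      rw [hJ' e he, H.J_v e he]
    J_fix1 := by
      rintro _ ⟨e, he, rfl⟩ x h0 h1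
      obtain ⟨a, rfl⟩ := H.surj x h0 (h1.trans (H.le1 e))
      rw [hJ' e he, H.J_φ e he, H.J_fix e he a h1]
    J_ker1 := by
      rintro _ ⟨e, he, rfl⟩ x h0 h1 h
      obtain ⟨a, rfl⟩ := H.surj x h0 h1
      rw [hJ' e he, H.J_φ e he, ← H.zero, H.inj.eq_iff, H.J_zero e he, ← H.compl] at h
      rw [hJc e he, H.J_φ _ (H.P_compl he), H.J_fix _ (H.P_compl he) a h]
    J_mackey := by
      rintro _ ⟨p, hp, rfl⟩ _ ⟨q, hq, rfl⟩ a b c ha hb hc hs e1 e2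
      obtain ⟨r, hr, h⟩ := CB.mackey p hp q hq
        ((H.mackey_iff p q).2 ⟨a, b, c, ha, hb, hc, hs, e1, e2⟩)
      refine ⟨φ r, ⟨r, hr, rfl⟩, fun x => ?_⟩
      have key : ∀ f : E, J (φ p) (J (φ q) (φ f)) = J (φ r) (φ f) := fun f => by
        rw [hJ' q hq, H.J_φ q hq, hJ' p hp, H.J_φ p hp, hJ' r hr, H.J_φ r hr, ← h]; rfl
      obtain ⟨N, -, f, rfl⟩ := H.rep x
      rw [← H.one]
      simp only [map_smul, map_sub, key]
    gencomp := by
      intro g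
      obtain ⟨p, ⟨⟨hp, hgp⟩, hbi⟩, h1, h2⟩ := hG g
      refine ⟨φ p, ⟨p, hp, rfl⟩, ?_, ?_, ?_, ?_⟩
      · rw [hJ' p hp, hJc p hp]; exact hgp
      · rintro _ ⟨q, hq, rfl⟩ h
        rw [hJ' q hq, hJc q hq] at h ⊢
        exact hbi q ⟨hq, h⟩
      · rw [hJc p hp]; exact h1
      · rw [hJ' p hp]; exact h2
    cover := by
      intro x h0 h1
      obtain ⟨a, rfl⟩ := H.surj x h0 h1
      obtain ⟨r, hr, h⟩ := hC a
      refine ⟨φ r, ⟨r, hr, rfl⟩, ?_⟩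
      rintro _ ⟨q, hq, rfl⟩
      rw [← H.le_iff, ← H.le_iff]; exact h q hq }
  exact ⟨S, { H with hu := rfl, hP := fun g => Iff.rfl, hJ := hJ' }⟩

namespace Lk

variable {S : SpecGrp G}


theorem memP (H : Lk EA CB φ v Jt S) {e : E} : φ e ∈ S.P ↔ e ∈ CB.P := by
  rw [H.hP]
  constructor
  · rintro ⟨f, hf, e⟩; rwa [← H.inj e]
  · intro h; exact ⟨e, h, rfl⟩

theorem exP (H : Lk EA CB φ v Jt S) {g : G} (h : g ∈ S.P) : ∃ e ∈ CB.P, φ e = g := (H.hP g).1 h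

theorem hJc (H : Lk EA CB φ v Jt S) {p : E} (hp : p ∈ CB.P) (x : G) : S.J (S.u - φ p) x = Jt (EA.compl p) x := by
  rw [H.hu, ← H.compl]; exact H.hJ _ (H.P_compl hp) x

theorem J_E (H : Lk EA CB φ v Jt S) {p : E} (hp : p ∈ CB.P) (a : E) : φ (CB.J p a) = S.J (φ p) (φ a) := by
  rw [H.hJ p hp, H.J_φ p hp]

theorem C_G (H : Lk EA CB φ v Jt S) {p : E} (hp : p ∈ CB.P) (g : G) : inCG EA Jt g p ↔ S.C g (φ p) := by
  unfold inCG SpecGrp.C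
  rw [H.hJ p hp, H.hJc hp]

theorem C_E (H : Lk EA CB φ v Jt S) {p : E} (hp : p ∈ CB.P) (a : E) : inC EA CB a p ↔ S.C (φ a) (φ p) := by
  rw [← H.inCG_iff a p hp, H.C_G hp]

theorem a0 (H : Lk EA CB φ v Jt S) (a : E) : 0 ≤ φ a := H.nn a
theorem a1 (H : Lk EA CB φ v Jt S) (a : E) : φ a ≤ S.u := H.hu ▸ H.le1 a

theorem compl' (H : Lk EA CB φ v Jt S) (a : E) : φ (EA.compl a) = S.u - φ a := by rw [H.hu, H.compl]

theorem exR (H : Lk EA CB φ v Jt S) (g : G) (l : ℚ) : ∃ e ∈ CB.P, φ e = S.Rl g l := H.exP (S.Rl_P g l)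

theorem C_of_bicomm (H : Lk EA CB φ v Jt S) (a q : E) (hq : q ∈ CB.P) (h : ∀ r ∈ bicomm EA CB a, inC EA CB r q) :
    inC EA CB a q := by
  rw [H.C_E hq]
  refine SpecGrp.C_of_Rl (H.a0 a) (H.a1 a) (H.memP.2 hq) fun n k _ => ?_
  obtain ⟨e, he, h2⟩ := H.exR (φ a) ((k:ℚ) / 2 ^ n)
  rw [← h2, ← H.C_E hq]
  refine h e ⟨⟨he, ?_⟩, fun r hr => ?_⟩
  · rw [H.C_E he, h2]; exact S.Rl_C _ _
  · rw [H.C_E hr.1, h2]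
    exact SpecGrp.Rl_bi (H.memP.2 hr.1) ((H.C_E hr.1 a).1 hr.2) _

theorem rick (H : Lk EA CB φ v Jt S) : ∃ rick : G → E, RickartMapG EA CB Jt rick := by
  have : ∀ g : G, ∃ e ∈ CB.P, ∀ p ∈ CB.P, (EA.le p e ↔ (inCG EA Jt g p ∧ Jt p g = 0)) := by
    intro g
    obtain ⟨r, hr, h⟩ := S.rickart g
    obtain ⟨e, he, rfl⟩ := H.exP hr
    refine ⟨e, he, fun p hp => ?_⟩
    rw [H.le_iff, h _ (H.memP.2 hp), H.C_G hp, H.hJ p hp]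
  choose r hr h using this
  exact ⟨r, fun g => ⟨hr g, h g⟩⟩

theorem mem_bicomm (H : Lk EA CB φ v Jt S) {a p : E} : p ∈ bicomm EA CB a ↔ p ∈ CB.P ∧ S.C (φ a) (φ p) ∧
    ∀ q ∈ S.P, S.C (φ a) q → S.C (φ p) q := by
  constructor
  · rintro ⟨⟨h1, h2⟩, h3⟩
    refine ⟨h1, (H.C_E h1 a).1 h2, ?_⟩
    intro q hq h
    obtain ⟨e, he, rfl⟩ := H.exP hq
    exact (H.C_E he p).1 (h3 e ⟨he, (H.C_E he a).2 h⟩)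
  · rintro ⟨h1, h2, h3⟩
    refine ⟨⟨h1, (H.C_E h1 a).2 h2⟩, ?_⟩
    rintro q ⟨hq, h⟩
    exact (H.C_E hq p).2 (h3 _ (H.memP.2 hq) ((H.C_E hq a).1 h))

theorem bproperty (H : Lk EA CB φ v Jt S) : BProperty EA CB := by
  intro a
  have hcompl : ∀ p ∈ bicomm EA CB a, EA.compl p ∈ bicomm EA CB a := by
    intro p hp
    rw [H.mem_bicomm] at hp ⊢
    obtain ⟨h1, h2, h3⟩ := hp
    rw [H.compl']
    exact ⟨H.P_compl h1, h2.compl, fun q hq h => (SpecGrp.C_u hq).sub (h3 q hq h)⟩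
  have hmeet : ∀ p ∈ bicomm EA CB a, ∀ q ∈ bicomm EA CB a, CB.J p q ∈ bicomm EA CB a := by
    intro p hp q hq
    rw [H.mem_bicomm] at hp hq ⊢
    obtain ⟨h1, h2, h3⟩ := hp
    obtain ⟨k1, k2, k3⟩ := hq
    have hpq := h3 _ (H.memP.2 k1) k2
    have m := SpecGrp.meet_eq (H.memP.2 h1) (H.memP.2 k1) hpq
    rw [← H.memP, H.J_E h1]
    refine ⟨m.1, SpecGrp.C_meet (H.memP.2 h1) (H.memP.2 k1) hpq h2 k2, fun r hr h => ?_⟩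
    have hr1 := (h3 r hr h).symm (H.memP.2 h1) hr
    have hr2 := (k3 r hr h).symm (H.memP.2 k1) hr
    exact (SpecGrp.C_meet (H.memP.2 h1) (H.memP.2 k1) hpq hr1 hr2).symm hr m.1
  have hadd : ∀ p ∈ bicomm EA CB a, ∀ q ∈ bicomm EA CB a, ∀ c, EA.padd p q = some c →
      c ∈ bicomm EA CB a := by
    intro p hp q hq c hc
    have hcP : c ∈ CB.P := CB.sub.2.2.2 p hp.1.1 q hq.1.1 c hc
    rw [H.padd_iff] at hc
    rw [H.mem_bicomm] at hp hq
    have hbi : ∀ r ∈ S.P, S.C (φ a) r → S.C (φ c) r := fun r hr h => by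
      rw [hc]; exact (hp.2.2 r hr h).add (hq.2.2 r hr h)
    refine H.mem_bicomm.2 ⟨hcP, ?_, hbi⟩
    have hpP := H.memP.2 hp.1
    have hqP := H.memP.2 hq.1
    have hpq := hp.2.2 _ hqP hq.2.1
    have e : φ c = S.u - S.J (S.u - φ p) (S.u - φ q) := by
      have hle : φ q ≤ S.u - φ p := by
        rw [le_sub_iff_add_le, add_comm, ← hc]; exact H.a1 c
      have h1 : S.J (S.u - φ p) (φ q) = φ q :=
        S.J_fix1 _ (S.P_compl _ hpP) _ (H.a0 q) hle
      rw [map_sub, h1, S.J_unit _ (S.P_compl _ hpP), hc]; abel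
    rw [e]
    refine SpecGrp.C.compl (SpecGrp.C_meet (S.P_compl _ hpP) (S.P_compl _ hqP) ?_
      hp.2.1.compl hq.2.1.compl)
    exact ((SpecGrp.C_u hqP).sub hpq).compl
  have hone : EA.one ∈ bicomm EA CB a := by
    rw [H.mem_bicomm, H.one, ← H.hu]
    refine ⟨CB.sub.2.1, ?_, fun q hq _ => SpecGrp.C_u hq⟩
    have : S.u ∈ S.P := by have := S.P_compl 0 S.P_zero; rwa [sub_zero] at this
    exact SpecGrp.C_le this (H.a0 a) (H.a1 a)
  have hsub : ∀ p ∈ bicomm EA CB a, ∀ q ∈ bicomm EA CB a, S.C (φ p) (φ q) := by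
    intro p hp q hq
    rw [H.mem_bicomm] at hp hq
    exact hp.2.2 _ (H.memP.2 hq.1) hq.2.1
  refine ⟨bicomm EA CB a, ⟨fun p hp => hp.1.1, ⟨?_, hone, hcompl, hadd⟩, ?_⟩, ?_⟩
  · have := hcompl _ hone
    have e : EA.compl EA.one = EA.zero := by
      apply H.inj; rw [H.compl, H.one, H.zero, sub_self]
    rwa [e] at this
  · intro p hp q hq
    have hpP := H.memP.2 hp.1.1
    have hqP := H.memP.2 hq.1.1
    have hc := hcompl q hq
    have hcp := hcompl p hp
    have e1 : φ p = φ (CB.J (EA.compl q) p) + φ (CB.J q p) := by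
      rw [H.J_E hc.1.1, H.J_E hq.1.1, H.compl', add_comm]
      exact hsub p hp q hq
    have e2 : φ q = φ (CB.J (EA.compl p) q) + φ (CB.J q p) := by
      rw [H.J_E hcp.1.1, H.J_E hq.1.1, H.compl', add_comm,
        ← (SpecGrp.symm_aux hpP hqP (hsub p hp q hq)).2.1]
      exact hsub q hq p hp
    have s1 : φ (CB.J (EA.compl q) p) + φ (CB.J (EA.compl p) q) + φ (CB.J q p) ≤ v := by
      have h1 : φ (CB.J (EA.compl p) q) ≤ v - φ p := by
        rw [H.J_E hcp.1.1, ← H.compl]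
        exact SpecGrp.J_le_self (H.memP.2 hcp.1.1) (H.a1 q)
      rw [e1] at h1
      have := le_sub_iff_add_le.1 h1
      refine (le_of_eq ?_).trans this
      abel
    obtain ⟨d, hd⟩ := H.surj (φ (CB.J (EA.compl q) p) + φ (CB.J (EA.compl p) q))
      (add_nonneg (H.nn _) (H.nn _)) ((le_add_of_nonneg_right (H.nn _)).trans s1)
    obtain ⟨f, hf⟩ := H.surj _ (add_nonneg (add_nonneg (H.nn _) (H.nn _)) (H.nn _)) s1
    refine ⟨_, hmeet _ hc _ hp, _, hmeet _ hcp _ hq, _, hmeet _ hq _ hp, d, f, ?_, ?_, ?_, ?_⟩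
    · rw [H.padd_iff, hd]
    · rw [H.padd_iff, hf, hd]
    · rw [H.padd_iff]; exact e1
    · rw [H.padd_iff]; exact e2
  · intro p hp
    exact ⟨fun h b hb => hb.2 p ⟨hp, h⟩, fun h => H.C_of_bicomm a p hp h⟩

theorem bcomp (H : Lk EA CB φ v Jt S) : BComparability EA CB := by
  refine ⟨H.bproperty, fun e f hef => ?_⟩
  -- `P(e)` commutes with `f`
  have key : ∀ e f : E, CommuteEl EA CB e f → ∀ r ∈ bicomm EA CB e, inC EA CB f r := by
    intro e f h r hr
    refine H.C_of_bicomm f r hr.1.1 fun s hs => ?_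
    exact H.inC_of_mackey s r hr.1.1 (H.mackey_symm _ _ (h r hr s hs))
  have hfe : CommuteEl EA CB f e := fun p hp q hq => H.mackey_symm _ _ (hef q hq p hp)
  obtain ⟨g', hp, hg, hbi, h1, h2⟩ := S.gencomp (φ f - φ e)
  obtain ⟨p, hpP, rfl⟩ := H.exP hp
  have sy : ∀ r ∈ S.P, S.C (φ e) r → S.C (φ f) r → S.C r (φ p) := by
    intro r hr he hf
    have : S.C (φ p) r := hbi r hr (hf.sub he)
    exact this.symm hp hr
  have hE : inC EA CB e p := by
    refine H.C_of_bicomm e p hpP fun r hr => ?_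
    rw [H.C_E hpP]
    exact sy _ (H.memP.2 hr.1.1) ((H.C_E hr.1.1 _).1 hr.1.2)
      ((H.C_E hr.1.1 _).1 (key e f hef r hr))
  have hF : inC EA CB f p := by
    refine H.C_of_bicomm f p hpP fun r hr => ?_
    rw [H.C_E hpP]
    exact sy _ (H.memP.2 hr.1.1) ((H.C_E hr.1.1 _).1 (key f e hfe r hr))
      ((H.C_E hr.1.1 _).1 hr.1.2)
  refine ⟨p, ⟨hpP, ?_⟩, ?_, ?_⟩
  · rintro a (⟨ha, h⟩ | (rfl | rfl))
    · rw [H.C_E hpP]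
      exact sy _ (H.memP.2 ha) ((H.C_E ha _).1 (h e (by simp))) ((H.C_E ha _).1 (h f (by simp)))
    · exact hE
    · exact hF
  · rw [H.le_iff, H.J_E hpP, H.J_E hpP]
    rwa [map_sub, sub_nonneg] at h2
  · rw [H.le_iff, H.J_E (H.P_compl hpP), H.J_E (H.P_compl hpP), H.compl']
    rwa [map_sub, sub_nonpos] at h1

end Lk

end

end EffectAlgebra

/-! ### Combinatorics of binary strings -/

namespace EffectAlgebra

theorem lamOf_append (w : List Bool) (b : Bool) :
    lamOf (w ++ [b]) = lamOf w + (if b then 1 else 0) / 2 ^ (w.length + 1) := by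
  induction w with
  | nil => simp [lamOf]
  | cons c t ih =>
    rw [List.cons_append, lamOf, lamOf, ih, List.length_cons]
    field_simp
    ring

theorem lamOf_nat (w : List Bool) : ∃ K : ℕ, K < 2 ^ w.length ∧ lamOf w = (K : ℚ) / 2 ^ w.length := by
  induction w with
  | nil => exact ⟨0, by simp, by simp [lamOf]⟩
  | cons c t ih =>
    obtain ⟨K, hK, h⟩ := ih
    refine ⟨(if c then 2 ^ t.length else 0) + K, ?_, ?_⟩
    · rw [List.length_cons, pow_succ]; split_ifs <;> omega
    · rw [lamOf, h, List.length_cons]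
      cases c <;> simp <;> field_simp <;> ring

theorem allStrings_length (n : ℕ) : ∀ w ∈ allStrings n, w.length = n := by
  induction n with
  | zero => simp [allStrings]
  | succ n ih =>
    intro w hw
    simp only [allStrings, List.mem_flatMap] at hw
    obtain ⟨t, ht, h⟩ := hw
    have := ih t ht
    simp only [List.mem_cons, List.not_mem_nil, or_false] at h
    rcases h with rfl | rfl <;> simp [this]

theorem range_flatMap {α : Type*} (f : ℕ → α) (M : ℕ) :
    (List.range M).flatMap (fun k => [f (2 * k), f (2 * k + 1)]) = (List.range (2 * M)).map f := by
  induction M with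
  | zero => simp
  | succ M ih =>
    rw [List.range_succ, List.flatMap_append, ih, show 2 * (M + 1) = 2 * M + 1 + 1 by ring,
      List.range_succ, List.range_succ]
    simp

theorem allStrings_lam (n : ℕ) :
    (allStrings n).map lamOf = (List.range (2 ^ n)).map (fun k : ℕ => (k : ℚ) / 2 ^ n) := by
  induction n with
  | zero => simp [allStrings, lamOf]
  | succ n ih =>
    rw [allStrings, List.map_flatMap, show 2 ^ (n + 1) = 2 * 2 ^ n from pow_succ' 2 n, ← range_flatMap]
    have h1 : ((allStrings n).flatMap fun w => List.map lamOf [w ++ [false], w ++ [true]]) =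
        ((allStrings n).map lamOf).flatMap (fun x : ℚ => [x, x + 1 / 2 ^ (n + 1)]) := by
      rw [List.flatMap_map]
      refine List.flatMap_congr fun w hw => ?_
      simp [lamOf_append, allStrings_length n w hw]
    rw [h1, ih, List.flatMap_map]
    refine List.flatMap_congr fun k _ => ?_
    simp only [List.cons.injEq, and_true]
    constructor
    · push_cast; field_simp; ring
    · push_cast; field_simp; ring

theorem exists_string (n k : ℕ) (hk : k < 2 ^ n) :
    ∃ w : List Bool, w.length = n ∧ lamOf w = (k : ℚ) / 2 ^ n := by
  have : (k : ℚ) / 2 ^ n ∈ (allStrings n).map lamOf := by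
    rw [allStrings_lam]
    exact List.mem_map.2 ⟨k, List.mem_range.2 hk, rfl⟩
  obtain ⟨w, hw, h⟩ := List.mem_map.1 this
  exact ⟨w, allStrings_length n w hw, h⟩

theorem exists_string1 (n k : ℕ) (h0 : 0 < k) (hk : k < 2 ^ n) :
    ∃ w : List Bool, lamOf (w ++ [true]) = (k : ℚ) / 2 ^ n := by
  induction n generalizing k with
  | zero => simp at hk; omega
  | succ n ih =>
    rw [pow_succ] at hk
    rcases Nat.even_or_odd' k with ⟨j, rfl | rfl⟩
    · obtain ⟨w, hw⟩ := ih j (by omega) (by omega)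
      refine ⟨w, ?_⟩
      rw [hw]; push_cast; field_simp; ring
    · obtain ⟨w, hl, hw⟩ := exists_string n j (by omega)
      refine ⟨w, ?_⟩
      rw [lamOf_append, hw, hl]; push_cast; simp; field_simp; ring

theorem filter_sum {G : Type*} [AddCommGroup G] (F : ℕ → G) (K M : ℕ) (f : ℕ → G)
    (hf : ∀ k, f k = F (k + 1) - F k) :
    (((List.range M).filter (fun k => k ≤ K)).map f).sum = F (min M (K + 1)) - F 0 := by
  induction M with
  | zero => simp
  | succ M ih =>
    rw [List.range_succ, List.filter_append, List.map_append, List.sum_append, ih]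
    by_cases h : M ≤ K
    · rw [min_eq_left (by omega), min_eq_left (by omega)]
      simp [h, hf]
    · rw [min_eq_right (by omega), min_eq_right (by omega)]
      simp [h]

/-! ### The binary spectral resolution inside the group -/

namespace Lk

variable {E : Type u} {EA : EffectAlgebra E} {CB : CompressionBase EA} {G : Type u}
    [AddCommGroup G] [PartialOrder G] [IsOrderedAddMonoid G] [Module ℚ G] [PosSMulMono ℚ G]
    {φ : E → G} {v : G} {Jt : E → G → G} {S : SpecGrp G}


theorem cov_le (H : Lk EA CB φ v Jt S) {r : E} {x : E} (h : S.IsCov (φ x) (φ r)) (q : E) (hq : q ∈ CB.P) :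
    EA.le x q ↔ EA.le r q := by
  have h2 := h.2 _ (H.memP.2 hq)
  rw [H.le_iff r q, ← h2, H.hJc hq, H.J_φ _ (H.P_compl hq), ← H.zero, H.inj.eq_iff,
    H.J_zero _ (H.P_compl hq), H.compl, H.le_iff]
  have e2 : v - (v - φ q) = φ q := by abel
  rw [e2]

theorem le_antisymm' (H : Lk EA CB φ v Jt S) {x y : E} (h1 : EA.le x y) (h2 : EA.le y x) : x = y := by
  rw [H.le_iff] at h1 h2; exact H.inj (le_antisymm h1 h2)

theorem le_refl' (H : Lk EA CB φ v Jt S) (x : E) : EA.le x x := (H.le_iff x x).2 le_rfl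

theorem projCover_eq (H : Lk EA CB φ v Jt S) {x r : E} (h : S.IsCov (φ x) (φ r)) : projCover EA CB x = r := by
  have hr : r ∈ CB.P := H.memP.1 h.1
  have h2 : IsProjCover EA CB x r := ⟨hr, fun q hq => H.cov_le h q hq⟩
  unfold projCover
  have hex : ∃ p, IsProjCover EA CB x p := ⟨r, h2⟩
  rw [dif_pos hex]
  obtain ⟨h3, h4⟩ := hex.choose_spec
  exact H.le_antisymm' ((h4 r hr).1 ((h2.2 r hr).2 (H.le_refl' _)))
    ((h2.2 _ h3).1 ((h4 _ h3).2 (H.le_refl' _)))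

theorem projCoverq_eq (H : Lk EA CB φ v Jt S) {q x r : E} (hrq : φ r ≤ φ q) (h : S.IsCov (φ x) (φ r)) :
    projCoverq EA CB q x = r := by
  have hr : r ∈ CB.P := H.memP.1 h.1
  have hr' : r ∈ Pq EA CB q := ⟨hr, (H.le_iff _ _).2 hrq⟩
  have h2 : IsProjCoverq EA CB q x r := ⟨hr', fun q hq => H.cov_le h q hq.1⟩
  unfold projCoverq
  have hex : ∃ p, IsProjCoverq EA CB q x p := ⟨r, h2⟩
  rw [dif_pos hex]
  obtain ⟨h3, h4⟩ := hex.choose_spec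
  exact H.le_antisymm' ((h4 r hr').1 ((h2.2 r hr').2 (H.le_refl' _)))
    ((h2.2 _ h3).1 ((h4 _ h3).2 (H.le_refl' _)))

theorem pmeet_eq (H : Lk EA CB φ v Jt S) {p q m : E} (h : IsMeetP EA CB p q m) : pmeet EA CB p q = m := by
  unfold pmeet
  have hex : ∃ m, IsMeetP EA CB p q m := ⟨m, h⟩
  rw [dif_pos hex]
  obtain ⟨h1, h2, h3, h4⟩ := hex.choose_spec
  obtain ⟨k1, k2, k3, k4⟩ := h
  exact H.le_antisymm' (k4 _ h1 h2 h3) (h4 _ k1 k2 k3)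

theorem pmeet_diff (H : Lk EA CB φ v Jt S) {p q : E} (hp : p ∈ CB.P) (hq : q ∈ CB.P) (h : φ q ≤ φ p) :
    φ (pmeet EA CB p (EA.compl q)) = φ p - φ q := by
  have hpP := H.memP.2 hp
  have hqP := H.memP.2 hq
  obtain ⟨m, hm, e⟩ := H.exP (SpecGrp.P_sub hpP hqP h)
  rw [← e]; congr 1
  refine H.pmeet_eq ⟨hm, ?_, ?_, ?_⟩
  · rw [H.le_iff, e]; exact sub_le_self _ (H.nn q)
  · rw [H.le_iff, e, H.compl]; exact sub_le_sub_right (H.le1 p) _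
  · intro s hs h1 h2
    rw [H.le_iff] at h1 h2 ⊢
    rw [H.compl'] at h2
    rw [e]
    exact SpecGrp.diff_meet hpP hqP h (H.memP.2 hs) h1 h2

theorem pmeet_le (H : Lk EA CB φ v Jt S) {p q : E} (hp : p ∈ CB.P) (h : φ p ≤ φ q) : pmeet EA CB p q = p :=
  H.pmeet_eq ⟨hp, H.le_refl' _, (H.le_iff _ _).2 h, fun _ _ h1 _ => h1⟩

theorem osubP (H : Lk EA CB φ v Jt S) {p q : E} (hp : p ∈ CB.P) (hq : q ∈ CB.P) (h : φ p ≤ φ q) : EA.osub q p ∈ CB.P := by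
  rw [← H.memP, H.osub h]
  exact SpecGrp.P_sub (H.memP.2 hq) (H.memP.2 hp) h

theorem inCq_iff (H : Lk EA CB φ v Jt S) {p q : E} (hp : p ∈ CB.P) (hq : q ∈ CB.P) (h : φ p ≤ φ q) (a : E) :
    inCq EA CB q a p ↔ φ a = S.J (φ p) (φ a) + S.J (φ q - φ p) (φ a) := by
  unfold inCq
  rw [H.padd_iff, H.J_E hp, H.J_E (H.osubP hp hq h), H.osub h]

/-- positive part in `[0,q]`. -/
theorem posPartq_spec (H : Lk EA CB φ v Jt S) {q c : E} (hq : q ∈ CB.P) (hc : φ c ≤ φ q) :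
    ∃ p ∈ CB.P, φ p ≤ φ q ∧ φ c = S.J (φ p) (φ c) + S.J (φ q - φ p) (φ c) ∧
      0 ≤ S.J (φ p) (φ c - (φ q - φ c)) ∧ S.J (φ q - φ p) (φ c - (φ q - φ c)) ≤ 0 ∧
      φ (posPartq EA CB q (EA.osub q c) c) = S.J (φ p) (φ c - (φ q - φ c)) := by
  have hqP := H.memP.2 hq
  have hne : (Pleq EA CB q (EA.osub q c) c).Nonempty := by
    obtain ⟨g, hg, hgq, h1, h2, h3, h4⟩ := SpecGrp.rel_exists hqP (H.a0 c) hc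
    obtain ⟨p, hp, rfl⟩ := H.exP hg
    have hop := H.osubP hp hq hgq
    refine ⟨p, ⟨⟨hp, (H.le_iff _ _).2 hgq⟩, ?_⟩, ?_, ?_⟩
    · rintro x (⟨⟨hx, hxq⟩, h⟩ | (rfl | rfl))
      · rw [H.le_iff] at hxq
        rw [H.inCq_iff hp hq hgq]
        refine h2 _ (H.memP.2 hx) hxq ?_
        rw [← H.inCq_iff hx hq hxq]
        exact h c (by simp)
      · rw [H.inCq_iff hp hq hgq, H.osub hc, map_sub, map_sub]
        have e1 : S.J (φ p) (φ q) = φ p := by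
          have k1 := (SpecGrp.symm_aux hqP hg (SpecGrp.C_P_le hqP hg hgq)).2.1
          rw [← k1]
          exact S.J_fix1 _ hqP _ (H.nn p) hgq
        have e2 : S.J (φ q - φ p) (φ q) = φ q - φ p := by
          have hd := SpecGrp.P_sub hqP hg hgq
          have hdq : φ q - φ p ≤ φ q := sub_le_self _ (H.nn p)
          have k1 := (SpecGrp.symm_aux hqP hd (SpecGrp.C_P_le hqP hd hdq)).2.1
          rw [← k1]
          exact S.J_fix1 _ hqP _ (S.P_nonneg _ hd) hdq
        rw [e1, e2]
        linear_combination (norm := module) -h1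
      · rw [H.inCq_iff hp hq hgq]; exact h1
    · rw [H.le_iff, H.J_E hp, H.J_E hp, H.osub hc]
      rwa [map_sub, sub_nonneg] at h3
    · rw [H.le_iff, H.J_E hop, H.J_E hop, H.osub hc, H.osub hgq]
      rwa [map_sub, sub_nonpos] at h4
  unfold posPartq
  rw [dif_pos hne]
  obtain ⟨⟨⟨hp, hpq⟩, hall⟩, h1, h2⟩ := hne.some_mem
  set p := hne.some
  rw [H.le_iff] at hpq
  have hop := H.osubP hp hq hpq
  have h3 := hall c (Or.inr (by simp))
  rw [H.inCq_iff hp hq hpq] at h3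
  rw [H.le_iff] at h1
  rw [H.le_iff, H.J_E hop, H.J_E hop, H.osub hc, H.osub hpq] at h2
  refine ⟨p, hp, hpq, h3, ?_, ?_, ?_⟩
  · rw [H.J_E hp, H.J_E hp, H.osub hc] at h1
    rwa [map_sub, sub_nonneg]
  · rwa [map_sub, sub_nonpos]
  · rw [H.osub h1, H.J_E hp, H.J_E hp, H.osub hc, ← map_sub]

theorem projCover_val (H : Lk EA CB φ v Jt S) (a : E) : φ (projCover EA CB a) = S.u - S.Rl (φ a) 0 := by
  have h := (SpecGrp.Rl_zero_cov (S := S) (H.a0 a)).2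
  obtain ⟨r, hr, e⟩ := H.exP h.1
  rw [← e] at h ⊢
  rw [H.projCover_eq h]

theorem ucAux_val (H : Lk EA CB φ v Jt S) (a : E) (t : List Bool) :
    φ (ucAux EA CB a t).1 = S.Rl (φ a) (lamOf t.reverse + 1 / 2 ^ t.length) -
        S.Rl (φ a) (lamOf t.reverse) ∧
      φ (ucAux EA CB a t).2 = (2 ^ t.length : ℚ) • (S.J (φ (ucAux EA CB a t).1) (φ a) -
        lamOf t.reverse • φ (ucAux EA CB a t).1) := by
  induction t with
  | nil =>
    have h1 : S.Rl (φ a) 1 = S.u := SpecGrp.Rl_one (H.a1 a) le_rfl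
    have h := (SpecGrp.Rl_zero_cov (S := S) (H.a0 a)).2
    simp only [ucAux, List.reverse_nil, lamOf, List.length_nil, pow_zero, div_one, zero_add,
      H.projCover_val, h1, one_smul, zero_smul, sub_zero, true_and]
    exact (SpecGrp.cov_fix h (H.a0 a)).symm
  | cons b t ih =>
    obtain ⟨hq, hc⟩ := ih
    rw [ucAux]
    set q := (ucAux EA CB a t).1
    set c := (ucAux EA CB a t).2
    set l := lamOf t.reverse with hl
    set N : ℚ := 2 ^ t.length with hN
    have hN0 : 0 < N := by positivity
    have hN1 : 0 < 1 / N := by positivity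
    set m := l + 1 / (2 * N) with hm
    have hN2 : 0 < 1 / (2 * N) := by positivity
    have hvm : l + 1 / N = m + 1 / (2 * N) := by rw [hm]; field_simp; ring
    have hlm : l ≤ m := by linarith
    have hmv : m < l + 1 / N := by linarith
    have hlv : l ≤ l + 1 / N := by linarith
    have hqP : q ∈ CB.P := by rw [← H.memP, hq]; exact S.diff_P _ hlv
    have hqS := H.memP.2 hqP
    have hJq : S.J (φ q) (φ a) ≤ (l + 1 / N) • φ q := by
      rw [hq]; exact S.diff_le _ hlv
    have hcq : φ c ≤ φ q := by
      rw [hc]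
      have := smul_le_smul_of_nonneg_left hJq hN0.le
      have e : N • (l + 1 / N) • φ q = (N * l + 1) • φ q := by
        rw [smul_smul]; congr 1; field_simp
      rw [e] at this
      linear_combination (norm := exact le_of_eq (by module)) this
    obtain ⟨p, hp, hpq, h1, h2, h3, h4⟩ := H.posPartq_spec hqP hcq
    set d := posPartq EA CB q (EA.osub q c) c
    have hg : φ c - (φ q - φ c) = (2 * N) • (S.J (φ q) (φ a) - m • φ q) := by
      rw [hc, hm]
      match_scalars
      · ring
      · field_simp; ring
    have hd : φ d = (2 * N) • (S.J (S.Rl (φ a) (l + 1 / N) - S.Rl (φ a) m) (φ a) -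
        m • (S.Rl (φ a) (l + 1 / N) - S.Rl (φ a) m)) := by
      rw [h4]
      rw [hq] at hpq h3 hg
      refine SpecGrp.step_pos hlm hmv.le (by positivity) (g := φ c - (φ q - φ c)) ?_
        (H.memP.2 hp) hpq ?_ h2 ?_
      · rw [← hg, hq]
      · have e1 : S.J (φ p) (φ q) = φ p := by
          have k1 := (SpecGrp.symm_aux hqS (H.memP.2 hp)
            (SpecGrp.C_P_le hqS (H.memP.2 hp) (hq ▸ hpq))).2.1
          rw [← k1]
          exact S.J_fix1 _ hqS _ (H.nn p) (hq ▸ hpq)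
        have e2 : S.J (φ q - φ p) (φ q) = φ q - φ p := by
          have hd := SpecGrp.P_sub hqS (H.memP.2 hp) (hq ▸ hpq)
          have hdq : φ q - φ p ≤ φ q := sub_le_self _ (H.nn p)
          have k1 := (SpecGrp.symm_aux hqS hd (SpecGrp.C_P_le hqS hd hdq)).2.1
          rw [← k1]
          exact S.J_fix1 _ hqS _ (S.P_nonneg _ hd) hdq
        rw [← hq]
        simp only [map_sub, e1, e2]
        linear_combination (norm := module) (2:ℚ) • h1
      · rw [← hq] at h3 ⊢; exact h3
    have hcov := SpecGrp.cov_step (S := S) (a := φ a) hmv (N := 2 * N) (by positivity)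
    rw [← hd] at hcov
    obtain ⟨r, hr, er⟩ := H.exP hcov.1
    rw [← er] at hcov
    have hrq : φ r ≤ φ q := by
      rw [er, hq]; exact sub_le_sub_left (S.Rl_mono _ hlm) _
    have hpc : projCoverq EA CB q d = r := H.projCoverq_eq hrq hcov
    simp only [hpc]
    have hoP := H.osubP hr hqP hrq
    have hov : φ (EA.osub q r) = S.Rl (φ a) m - S.Rl (φ a) l := by
      rw [H.osub hrq, hq, er]; abel
    have hoq : φ (EA.osub q r) ≤ φ q := by
      rw [H.osub hrq]; exact sub_le_self _ (H.nn r)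
    rw [H.pmeet_le hoP hoq]
    set u0 := EA.osub q r
    have hlen : (2:ℚ) ^ (b :: t).length = 2 * N := by
      rw [List.length_cons, pow_succ, hN]; ring
    have hrev : lamOf (b :: t).reverse = l + (if b then 1 else 0) / (2 * N) := by
      rw [List.reverse_cons, lamOf_append, List.length_reverse, pow_succ, ← hN, mul_comm]
    rw [hlen, hrev]
    cases b with
    | true =>
      have hu1 : φ (pmeet EA CB q (EA.compl u0)) = S.Rl (φ a) (l + 1 / N) - S.Rl (φ a) m := by
        rw [H.pmeet_diff hqP hoP hoq, hov, hq]; abel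
      simp only [if_true]
      rw [← hm, ← hvm]
      exact ⟨hu1, by rw [hu1]; exact hd⟩
    | false =>
      simp only [Bool.false_eq_true, if_false, zero_div, add_zero]
      rw [← hm]
      refine ⟨hov, ?_⟩
      have hoS := H.memP.2 hoP
      have hCo : S.C (φ u0) (φ q) := SpecGrp.C_le hqS (H.nn _) hoq
      have e1 : S.J (φ u0) (S.J (φ q) (φ a)) = S.J (φ u0) (φ a) := by
        rw [SpecGrp.J_comm hoS hqS hCo, SpecGrp.J_of_le hqS hoS hoq]
      have e2 : S.J (φ u0) (φ q) = φ u0 := by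
        rw [(SpecGrp.symm_aux hoS hqS hCo).2.1]
        exact S.J_fix1 _ hqS _ (H.nn _) hoq
      have e3 : φ (CB.J u0 c) = N • (S.J (φ u0) (φ a) - l • φ u0) := by
        rw [H.J_E hoP, hc, map_smul, map_sub, map_smul, e1, e2]
      rw [H.oplusD, e3]
      · module
      · have hJu : S.J (φ u0) (φ a) ≤ m • φ u0 := by
          rw [hov]; exact S.diff_le _ hlm
        have h5 := smul_le_smul_of_nonneg_left hJu (show 0 ≤ 2 * N by positivity)
        have e : (2 * N) • m • φ u0 = (2 * N * l + 1) • φ u0 := by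
          rw [smul_smul]; congr 1; rw [hm]; field_simp
        rw [e] at h5
        rw [e3]
        have h6 := H.le1 u0
        linear_combination (norm := exact le_of_eq (by module)) h5 + h6

theorem uw_val (H : Lk EA CB φ v Jt S) (a : E) (w : List Bool) :
    φ (uw EA CB a w) = S.Rl (φ a) (lamOf w + 1 / 2 ^ w.length) - S.Rl (φ a) (lamOf w) := by
  have := (H.ucAux_val a w.reverse).1
  rwa [List.reverse_reverse, List.length_reverse] at this

theorem foldl_val (H : Lk EA CB φ v Jt S) (l : List E) (x : E) (h : φ x + (l.map φ).sum ≤ v) :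
    φ (l.foldl (fun acc x => EA.oplusD acc x) x) = φ x + (l.map φ).sum := by
  induction l generalizing x with
  | nil => simp
  | cons y l ih =>
    rw [List.foldl_cons]
    rw [List.map_cons, List.sum_cons, ← add_assoc] at h ⊢
    have hs : 0 ≤ (l.map φ).sum := by
      apply List.sum_nonneg
      intro z hz
      obtain ⟨e, -, rfl⟩ := List.mem_map.1 hz
      exact H.nn e
    have e : φ (EA.oplusD x y) = φ x + φ y := H.oplusD ((le_add_of_nonneg_right hs).trans h)
    rw [ih _ (by rw [e]; exact h), e]

theorem pbin_val (H : Lk EA CB φ v Jt S) (a : E) (w : List Bool) :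
    φ (pbin EA CB a w) = S.Rl (φ a) (lamOf (w ++ [true])) := by
  obtain ⟨K, hK, hlK⟩ := lamOf_nat (w ++ [false])
  have hlen : (w ++ [false]).length = w.length + 1 := by simp
  rw [hlen] at hK hlK
  set n := w.length + 1 with hn
  have hval : lamOf (w ++ [true]) = ((K + 1 : ℕ) : ℚ) / 2 ^ n := by
    have h2 := lamOf_append w true
    have h3 := lamOf_append w false
    simp only [if_true, Bool.false_eq_true, if_false, zero_div, add_zero] at h2 h3
    rw [h2, ← h3, hlK, ← hn, ← add_div]; push_cast; rfl
  have hsum : ((((allStrings n).filter fun v => lamOf v ≤ lamOf (w ++ [false])).map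
      (uw EA CB a)).map φ).sum = S.Rl (φ a) (lamOf (w ++ [true])) - S.Rl (φ a) 0 := by
    have e1 : (((allStrings n).filter fun v => lamOf v ≤ lamOf (w ++ [false])).map
      (uw EA CB a)).map φ = ((((allStrings n).map lamOf).filter
        fun x => x ≤ (K:ℚ) / 2 ^ n).map fun x =>
          S.Rl (φ a) (x + 1 / 2 ^ n) - S.Rl (φ a) x) := by
      rw [List.filter_map, List.map_map, List.map_map, hlK]
      refine List.map_congr_left fun x hx => ?_
      have hx2 := allStrings_length n x (List.mem_of_mem_filter hx)
      simp only [Function.comp_apply, H.uw_val, hx2]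
    have e2 : (fun k : ℕ => decide (k ≤ K)) =
        (fun x : ℚ => decide (x ≤ (K:ℚ) / 2 ^ n)) ∘ fun k : ℕ => (k:ℚ) / 2 ^ n := by
      funext k
      simp only [Function.comp_apply, decide_eq_decide]
      rw [div_le_div_iff_of_pos_right (by positivity), Nat.cast_le]
    rw [e1, allStrings_lam, List.filter_map, List.map_map, ← e2,
      filter_sum (fun k : ℕ => S.Rl (φ a) ((k:ℚ) / 2 ^ n)), min_eq_right (by omega), hval]
    · simp
    · intro k
      simp only [Function.comp_apply]
      rw [← add_div]; push_cast; rfl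
  unfold pbin listSum
  rw [H.foldl_val, List.map_cons, List.sum_cons, hsum, H.zero, H.compl', H.projCover_val]
  · abel
  · rw [List.map_cons, List.sum_cons, hsum, H.zero, H.compl', H.projCover_val, ← H.hu]
    refine (le_of_eq ?_).trans (S.P_le _ (S.Rl_P (φ a) (lamOf (w ++ [true]))))
    abel

theorem pdyad_val (H : Lk EA CB φ v Jt S) (a : E) (n k : ℕ) (hk : k ≤ 2 ^ n) :
    φ (pdyad EA CB a ((k:ℚ) / 2 ^ n)) = S.Rl (φ a) ((k:ℚ) / 2 ^ n) := by
  unfold pdyad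
  rcases Nat.eq_zero_or_pos k with rfl | h0
  · simp only [Nat.cast_zero, zero_div, le_refl, if_true]
    rw [H.compl', H.projCover_val]; abel
  · have hx0 : (0:ℚ) < (k:ℚ) / 2 ^ n := by positivity
    rw [if_neg (not_le.2 hx0)]
    by_cases h1 : 1 ≤ (k:ℚ) / 2 ^ n
    · rw [if_pos h1, H.one, ← H.hu, SpecGrp.Rl_one (H.a1 a) h1]
    · rw [if_neg h1]
      have hlt : k < 2 ^ n := by
        rcases lt_or_eq_of_le hk with h | h
        · exact h
        · exfalso; apply h1; rw [h]; push_cast; rw [div_self (by positivity)]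
      have hex := exists_string1 n k h0 hlt
      rw [dif_pos hex, H.pbin_val, hex.choose_spec]

theorem pdyad_lam (H : Lk EA CB φ v Jt S) (a : E) (w : List Bool) :
    φ (pdyad EA CB a (lamOf w)) = S.Rl (φ a) (lamOf w) := by
  obtain ⟨K, hK, h⟩ := lamOf_nat w
  rw [h]; exact H.pdyad_val a _ K hK.le

theorem pdyad_P (H : Lk EA CB φ v Jt S) (a : E) (n k : ℕ) (hk : k ≤ 2 ^ n) : pdyad EA CB a ((k:ℚ) / 2 ^ n) ∈ CB.P := by
  rw [← H.memP, H.pdyad_val a n k hk]; exact S.Rl_P _ _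

end Lk

end EffectAlgebra

/-! ### The final statements -/

namespace EffectAlgebra

namespace Lk

variable {E : Type u} {EA : EffectAlgebra E} {CB : CompressionBase EA} {G : Type u}
    [AddCommGroup G] [PartialOrder G] [IsOrderedAddMonoid G] [Module ℚ G] [PosSMulMono ℚ G]
    {φ : E → G} {v : G} {Jt : E → G → G} {S : SpecGrp G}


theorem infP_eq (H : Lk EA CB φ v Jt S) {T : Set E} {m m' : E} (h : IsInfP EA CB T m) (h' : IsInfP EA CB T m') :
    m = m' :=
  H.le_antisymm' (h'.2.2 m h.1 h.2.1) (h.2.2 m' h'.1 h'.2.1)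

theorem ratRes_val (H : Lk EA CB φ v Jt S) (a : E) (x : ℚ) (h0 : 0 ≤ x) (h1 : x ≤ 1) :
    φ (ratRes EA CB a x) = S.Rl (φ a) x := by
  obtain ⟨e, he, hv⟩ := H.exR (φ a) x
  have hinf : IsInfP EA CB {y | ∃ μ, Dyadic01 μ ∧ x < μ ∧ y = pdyad EA CB a μ} e := by
    refine ⟨he, ?_, ?_⟩
    · rintro _ ⟨μ, ⟨n, k, hk, rfl⟩, hlt, rfl⟩
      have hk' : k ≤ 2 ^ n := by exact_mod_cast hk
      rw [H.le_iff, hv, H.pdyad_val a n k hk']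
      exact S.Rl_mono _ hlt.le
    · intro t ht h
      rw [H.le_iff, hv]
      rcases lt_or_eq_of_le h1 with h1 | rfl
      · refine SpecGrp.Rl_inf (H.memP.2 ht) fun n => ?_
        have hp : (0:ℚ) < 2 ^ n := by positivity
        set k := ⌊x * 2 ^ n⌋₊ + 1 with hk
        have hk1 : x * 2 ^ n < k := by
          rw [hk]; push_cast; exact Nat.lt_floor_add_one _
        have hk2 : (k:ℚ) ≤ x * 2 ^ n + 1 := by
          rw [hk]; push_cast
          have := Nat.floor_le (show 0 ≤ x * 2 ^ n by positivity)
          linarith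
        have hk3 : k ≤ 2 ^ n := by
          have : ⌊x * 2 ^ n⌋₊ < 2 ^ n := by
            rw [Nat.floor_lt (by positivity)]; push_cast; nlinarith
          omega
        have hlt : x < (k:ℚ) / 2 ^ n := by rw [lt_div_iff₀ hp]; exact hk1
        refine ⟨(k:ℚ) / 2 ^ n, hlt.le, ?_, ?_⟩
        · rw [div_le_iff₀ hp, add_mul, one_div, inv_mul_cancel₀ hp.ne']; exact hk2
        · have := h _ ⟨(k:ℚ) / 2 ^ n, ⟨n, k, by exact_mod_cast hk3, rfl⟩, hlt, rfl⟩
          rwa [H.le_iff, H.pdyad_val a n k hk3] at this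
      · rw [SpecGrp.Rl_one (H.a1 a) le_rfl]; exact H.a1 t
  have hex : ∃ m, IsInfP EA CB {y | ∃ μ, Dyadic01 μ ∧ x < μ ∧ y = pdyad EA CB a μ} m := ⟨e, hinf⟩
  unfold ratRes
  rw [dif_pos hex, H.infP_eq hex.choose_spec hinf, hv]

theorem part1 (H : Lk EA CB φ v Jt S) (a : E) (rick : G → E) (hr : RickartMapG EA CB Jt rick) (lam : ℚ) (h0 : 0 ≤ lam)
    (h1 : lam ≤ 1) (m n : ℕ) (hn : 0 < n) (hlam : lam = (m : ℚ) / (n : ℚ)) (p : E)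
    (hp : p ∈ bicommG EA CB Jt φ (n • φ a - m • v))
    (hneg : Jt (EA.compl p) (n • φ a - m • v) ≤ 0)
    (hpos : 0 ≤ Jt p (n • φ a - m • v)) :
    rick (Jt p (n • φ a - m • v)) = ratRes EA CB a lam := by
  apply H.inj
  rw [H.ratRes_val a lam h0 h1]
  have hn' : (0:ℚ) < n := by exact_mod_cast hn
  set g := n • φ a - m • v with hg
  have hg2 : g = (n:ℚ) • (φ a - lam • S.u) := by
    rw [hg, smul_sub, smul_smul, hlam, mul_div_cancel₀ _ hn'.ne', H.hu,
      Nat.cast_smul_eq_nsmul, Nat.cast_smul_eq_nsmul]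
  obtain ⟨⟨hpP, hgp⟩, hbi⟩ := hp
  obtain ⟨hrP, hrk⟩ := hr (Jt p g)
  have hM := (SpecGrp.max_of_pos (S := S) (g := g) (p := φ p) (r := φ (rick (Jt p g)))
    (H.memP.2 hpP) ((H.C_G hpP g).1 hgp) (by
      intro q hq h
      obtain ⟨e, he, rfl⟩ := H.exP hq
      exact (H.C_G he _).1 (hbi e ⟨he, (H.C_G he g).2 h⟩))
    (by rw [H.hJ p hpP]; exact hpos) (by rw [H.hJc hpP]; exact hneg) (H.memP.2 hrP) (by
      intro q hq
      obtain ⟨e, he, rfl⟩ := H.exP hq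
      rw [H.hJ p hpP, ← H.le_iff, hrk e he, H.C_G he, H.hJ e he])).1
  have hM2 := (S.R_isMax (φ a - lam • S.u)).smul hn'
  rw [← hg2] at hM2
  exact hM.unique hM2

theorem sum_eq (H : Lk EA CB φ v Jt S) (a : E) (n : ℕ) :
    ((allStrings n).map fun w =>
              lamOf w • φ (pmeet EA CB
                (pdyad EA CB a (lamOf w + (1 / 2) ^ w.length))
                (EA.compl (pdyad EA CB a (lamOf w))))).sum =
    ∑ k ∈ Finset.range (2 ^ n), ((k : ℚ) / (2 ^ n : ℕ)) •
      (S.Rl (φ a) ((k + 1 : ℚ) / (2 ^ n : ℕ)) - S.Rl (φ a) ((k : ℚ) / (2 ^ n : ℕ))) := by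
  have e : ((allStrings n).map fun w =>
              lamOf w • φ (pmeet EA CB
                (pdyad EA CB a (lamOf w + (1 / 2) ^ w.length))
                (EA.compl (pdyad EA CB a (lamOf w))))) =
      ((allStrings n).map lamOf).map fun x => x • (S.Rl (φ a) (x + 1 / 2 ^ n) - S.Rl (φ a) x) := by
    rw [List.map_map]
    refine List.map_congr_left fun w hw => ?_
    simp only [Function.comp_apply]
    have hl := allStrings_length n w hw
    obtain ⟨K, hK, h⟩ := lamOf_nat w
    rw [hl] at hK h
    have e2 : lamOf w + (1 / 2) ^ w.length = ((K + 1 : ℕ) : ℚ) / 2 ^ n := by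
      rw [h, hl, one_div_pow]; push_cast; ring
    have e3 : lamOf w + 1 / 2 ^ n = ((K + 1 : ℕ) : ℚ) / 2 ^ n := by
      rw [h]; push_cast; ring
    rw [e2, e3, h]
    congr 1
    have k1 := H.pdyad_val a n (K + 1) hK
    have k2 := H.pdyad_val a n K hK.le
    rw [H.pmeet_diff (H.pdyad_P a n _ hK) (H.pdyad_P a n K hK.le), k1, k2]
    rw [k1, k2]
    refine S.Rl_mono _ ?_
    push_cast
    gcongr
    linarith
  rw [e, allStrings_lam, List.map_map, ← List.sum_toFinset _ List.nodup_range, List.toFinset_range]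
  refine Finset.sum_congr rfl fun k _ => ?_
  simp only [Function.comp_apply]
  push_cast
  rw [add_div]

theorem part2 (H : Lk EA CB φ v Jt S) (a : E) (ε : ℚ) (hε : 0 < ε) : ∃ N : ℕ, ∀ n ≥ N,
        -(ε • v) ≤ φ a -
            ((allStrings n).map fun w =>
              lamOf w • φ (pmeet EA CB
                (pdyad EA CB a (lamOf w + (1 / 2) ^ w.length))
                (EA.compl (pdyad EA CB a (lamOf w))))).sum ∧
        φ a -
            ((allStrings n).map fun w =>
              lamOf w • φ (pmeet EA CB
                (pdyad EA CB a (lamOf w + (1 / 2) ^ w.length))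
                (EA.compl (pdyad EA CB a (lamOf w))))).sum ≤ ε • v := by
  obtain ⟨N, hN⟩ := pow_unbounded_of_one_lt (1 / ε) (one_lt_two : (1:ℚ) < 2)
  refine ⟨N, fun n hn => ?_⟩
  rw [H.sum_eq a n]
  obtain ⟨h1, h2⟩ := SpecGrp.approx (S := S) (H.a0 a) (H.a1 a) (2 ^ n) (by positivity)
  have hv := H.v_nn
  refine ⟨le_trans (neg_nonpos.2 (smul_nonneg hε.le hv)) h1, h2.trans ?_⟩
  rw [H.hu]
  have hle : (1 / ((2 ^ n : ℕ) : ℚ)) ≤ ε := by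
    push_cast
    rw [div_le_iff₀ (by positivity)]
    have h3 : (2:ℚ) ^ N ≤ 2 ^ n := pow_le_pow_right₀ one_le_two hn
    rw [div_lt_iff₀ hε] at hN
    nlinarith
  have := smul_nonneg (sub_nonneg.2 hle) hv
  rw [sub_smul] at this
  exact sub_nonneg.1 this

theorem part3 (H : Lk EA CB φ v Jt S) (a b : E) : a = b ↔
        ∀ w : List Bool, pdyad EA CB a (lamOf w) = pdyad EA CB b (lamOf w) := by
  constructor
  · rintro rfl w; rfl
  · intro h
    apply H.inj
    refine SpecGrp.eq_of_Rl (S := S) (H.a0 a) (H.a1 a) (H.a0 b) (H.a1 b) fun n k hk => ?_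
    rcases lt_or_eq_of_le hk with hk | hk
    · obtain ⟨w, -, hw⟩ := exists_string n k hk
      rw [← hw, ← H.pdyad_lam, ← H.pdyad_lam, h w]
    · have e : (1:ℚ) ≤ (k:ℚ) / 2 ^ n := by
        rw [hk]; push_cast; rw [div_self (by positivity)]
      rw [SpecGrp.Rl_one (H.a1 a) e, SpecGrp.Rl_one (H.a1 b) e]

theorem part4 (H : Lk EA CB φ v Jt S) (a q : E) (hq : q ∈ CB.P) : inC EA CB a q ↔
        ∀ w : List Bool, inC EA CB (pdyad EA CB a (lamOf w)) q := by
  rw [H.C_E hq]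
  constructor
  · intro h w
    rw [H.C_E hq, H.pdyad_lam]
    exact SpecGrp.Rl_bi (H.memP.2 hq) h _
  · intro h
    refine SpecGrp.C_of_Rl (H.a0 a) (H.a1 a) (H.memP.2 hq) fun n k hk => ?_
    rcases lt_or_eq_of_le hk with hk | hk
    · obtain ⟨w, -, hw⟩ := exists_string n k hk
      rw [← hw, ← H.pdyad_lam, ← H.C_E hq]; exact h w
    · have e : (1:ℚ) ≤ (k:ℚ) / 2 ^ n := by
        rw [hk]; push_cast; rw [div_self (by positivity)]
      rw [SpecGrp.Rl_one (H.a1 a) e]; exact SpecGrp.C_u (H.memP.2 hq)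

end Lk

end EffectAlgebra

open EffectAlgebra in
/-- for an archimedean divisible effect algebra `E` with universal group
`(G,u)` and extended compression base `Jt`: `E` is spectral iff `G` is spectral (general
comparability + Rickart property). In this case, for every `a ∈ E`:
(i) the rational spectral resolution of `a` in `E` coincides with the one in `G`
(`p_{a,λ} = ((n·a − m·u)_+)^*` for `λ = m/n`, the positive part given by any orthogonal
decomposition); (ii) `a = lim_n Σ_{l(w)=n} λ(w) u_w` in the order-unit norm of `G`, with
`u_w = p_{a,λ(w+1)} ∧ p_{a,λ(w)}'`; (iii) `a = b` iff `a` and `b` have the same binary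
spectral resolution; (iv) `a ∈ C(q)` iff all `p_{a,λ(w)} ∈ C(q)`. -/
theorem statement19 {E : Type u} (EA : EffectAlgebra E) (CB : CompressionBase EA)
    (harch : EA.ArchimedeanEA)
    (hdiv : ∀ a : E, ∀ n : ℕ, 0 < n → ∃! x : E, EA.nsmulE n x = some a)
    {G : Type u} [AddCommGroup G] [PartialOrder G]
    [CovariantClass G G (· + ·) (· ≤ ·)]
    (u : G) (hu : OrderUnit u) (φ : E → G)
    (hφ1 : φ EA.one = u)
    (hmem : ∀ a : E, 0 ≤ φ a ∧ φ a ≤ u)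
    (hinj : Function.Injective φ)
    (hsurj : ∀ g : G, 0 ≤ g → g ≤ u → ∃ a : E, φ a = g)
    (hpadd : ∀ a b : E, ∀ c : E,
      (EA.padd a b = some c ↔ φ a + φ b ≤ u ∧ φ c = φ a + φ b))
    (huniv : ∀ (H : Type u) [AddCommGroup H], ∀ ψ : E → H,
      (∀ a b c : E, EA.padd a b = some c → ψ c = ψ a + ψ b) →
      ∃! h : G → H, (∀ x y : G, h (x + y) = h x + h y) ∧ ∀ a : E, h (φ a) = ψ a)
    (Jt : E → G → G)
    (hJt : ∀ p ∈ CB.P, (∀ x y : G, Jt p (x + y) = Jt p x + Jt p y) ∧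
      (∀ x y : G, x ≤ y → Jt p x ≤ Jt p y) ∧
      ∀ a : E, Jt p (φ a) = φ (CB.J p a))
    [Module ℚ G] :
    (Spectral EA CB ↔
      (GenCompG EA CB Jt φ ∧ ∃ rick : G → E, RickartMapG EA CB Jt rick)) ∧
    (Spectral EA CB → ∀ a : E,
      -- (i) the rational spectral resolutions in `E` and in `G` coincide
      (∀ rick : G → E, RickartMapG EA CB Jt rick →
        ∀ lam : ℚ, 0 ≤ lam → lam ≤ 1 → ∀ m n : ℕ, 0 < n → lam = (m : ℚ) / (n : ℚ) →
        ∀ p ∈ bicommG EA CB Jt φ (n • φ a - m • u),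
          Jt (EA.compl p) (n • φ a - m • u) ≤ 0 →
          0 ≤ Jt p (n • φ a - m • u) →
          rick (Jt p (n • φ a - m • u)) = ratRes EA CB a lam) ∧
      -- (ii) `a` is the norm limit of `Σ_{l(w)=n} λ(w) u_w`
      (∀ ε : ℚ, 0 < ε → ∃ N : ℕ, ∀ n ≥ N,
        -(ε • u) ≤ φ a -
            ((allStrings n).map fun w =>
              lamOf w • φ (pmeet EA CB
                (pdyad EA CB a (lamOf w + (1 / 2) ^ w.length))
                (EA.compl (pdyad EA CB a (lamOf w))))).sum ∧
        φ a -
            ((allStrings n).map fun w =>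
              lamOf w • φ (pmeet EA CB
                (pdyad EA CB a (lamOf w + (1 / 2) ^ w.length))
                (EA.compl (pdyad EA CB a (lamOf w))))).sum ≤ ε • u) ∧
      -- (iii) `a` is determined by its binary spectral resolution
      (∀ b : E, a = b ↔
        ∀ w : List Bool, pdyad EA CB a (lamOf w) = pdyad EA CB b (lamOf w)) ∧
      -- (iv) compatibility with a projection is detected by the spectral resolution
      (∀ q ∈ CB.P, inC EA CB a q ↔
        ∀ w : List Bool, inC EA CB (pdyad EA CB a (lamOf w)) q)) := by
  haveI hoam : IsOrderedAddMonoid G :=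
    { add_le_add_left := fun x y hxy c => by
        have h : c + x ≤ c + y := CovariantClass.elim c hxy
        rwa [add_comm c x, add_comm c y] at h }
  have H : Ctx EA CB φ u Jt :=
    { one := hφ1
      nn := fun a => (hmem a).1
      le1 := fun a => (hmem a).2
      inj := hinj
      surj := hsurj
      padd := hpadd
      unit := hu.2
      arch := harch
      div := by
        intro a n hn
        obtain ⟨x, hx, -⟩ := hdiv a n hn
        have hE : Emb EA φ u :=
          ⟨hφ1, fun a => (hmem a).1, fun a => (hmem a).2, hinj, hsurj, hpadd⟩
        have hn' : (n:ℚ) ≠ 0 := by exact_mod_cast hn.ne'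
        refine ⟨x, ?_⟩
        rw [hE.nsmul_eq n x a hx, ← Nat.cast_smul_eq_nsmul ℚ, smul_smul, one_div,
          inv_mul_cancel₀ hn', one_smul]
      gen := by
        intro g
        obtain ⟨h, -, hh⟩ := huniv (G ⧸ AddSubgroup.closure (Set.range φ)) (fun _ => 0)
          (fun _ _ _ _ => (add_zero _).symm)
        have h1 := hh (fun x => QuotientAddGroup.mk' (AddSubgroup.closure (Set.range φ)) x)
          ⟨fun x y => map_add _ x y, fun a => by
            refine (QuotientAddGroup.eq_zero_iff (φ a)).2 ?_
            exact AddSubgroup.subset_closure ⟨a, rfl⟩⟩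
        have h2 := hh (fun _ => 0) ⟨fun x y => (add_zero _).symm, fun a => rfl⟩
        have h3 := congrFun (h1.trans h2.symm) g
        exact (QuotientAddGroup.eq_zero_iff g).1 h3
      J_add := fun p hp => (hJt p hp).1
      J_mono := fun p hp => (hJt p hp).2.1
      J_φ := fun p hp => (hJt p hp).2.2 }
  have key : Spectral EA CB → ∃ (_ : PosSMulMono ℚ G) (S : SpecGrp G), Lk EA CB φ u Jt S := by
    intro hS
    have hG := H.gencomp hS
    haveI := H.posSMul hG
    exact ⟨this, H.exists_S hG hS.1⟩
  refine ⟨⟨fun hS => ?_, ?_⟩, fun hS a => ?_⟩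
  · obtain ⟨_, S, hL⟩ := key hS
    exact ⟨H.gencomp hS, hL.rick⟩
  · rintro ⟨hG, rick, hr⟩
    haveI := H.posSMul hG
    have hC := H.cover_of_rick rick hr
    obtain ⟨S, hL⟩ := H.exists_S hG hC
    exact ⟨hC, hL.bcomp⟩
  · obtain ⟨_, S, hL⟩ := key hS
    exact ⟨hL.part1 a, hL.part2 a, hL.part3 a, hL.part4 a⟩
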